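/- There exist a constant C > 0 and an integer M ≥ 0 such that ‖Op_ħ(a)‖_{L²(dq)→L²(dq)} ≤ C Σ_{|A|+|B|+|A'|≤M} ħ^{(|A|+|B|+|A'|)/2} ‖∂_q^A ∂_p^B ∂_{q'}^{A'} a‖_{L^∞(ℝ^{3n})} for all a ∈ BS^0_0(1) and all ħ ∈ (0,1]. -/

import Mathlib

open MeasureTheory Real
open scoped BigOperators Classical

noncomputable section

/-- Points of `ℝⁿ`. The coordinate `q 0` plays the role of the radial variable `r`,
the remaining coordinates are the angular variables `θ`. -/
abbrev Vec (n : ℕ) := Fin n → ℝ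

/-- Complex-valued partial derivative in the coordinate direction `i`. -/
def pdC {n : ℕ} (i : Fin n) (f : Vec n → ℂ) : Vec n → ℂ :=
  fun x => fderiv ℝ f x (Pi.single i 1)

/-- Iterated (multiindex) partial derivative `∂^A f`. -/
def mpd {n : ℕ} (A : Fin n → ℕ) (f : Vec n → ℂ) : Vec n → ℂ :=
  (List.finRange n).foldr (fun i g => (pdC i)^[A i] g) f

/-- Real-valued partial derivative in the coordinate direction `i`. -/
def pdR {n : ℕ} (i : Fin n) (f : Vec n → ℝ) : Vec n → ℝ :=
  fun x => fderiv ℝ f x (Pi.single i 1)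

/-- Iterated (multiindex) partial derivative, real valued. -/
def mpdR {n : ℕ} (A : Fin n → ℕ) (f : Vec n → ℝ) : Vec n → ℝ :=
  (List.finRange n).foldr (fun i g => (pdR i)^[A i] g) f

/-- Total length `|A| = α₀ + |α|` of a multiindex. -/
def fullLen {n : ℕ} (A : Fin n → ℕ) : ℕ := ∑ i, A i

/-- Angular length `|α|` of a multiindex `A = (α₀, α)`. -/
def angLen {n : ℕ} [NeZero n] (A : Fin n → ℕ) : ℕ := ∑ i, if i = 0 then 0 else A i

/-- The weighted Japanese bracket `⟨ρ ⊕ μ⁻¹ η⟩ = (1 + ρ² + μ⁻²|η|²)^(1/2)`,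
where `ρ = p 0` and `η` are the remaining coordinates of `p`. -/
def jbr {n : ℕ} [NeZero n] (μ : ℝ) (p : Vec n) : ℝ :=
  Real.sqrt (1 + ∑ i, (if i = 0 then p i else μ⁻¹ * p i) ^ 2)

/-- Derivative `∂_q^A` of a function `a(q, p)` in the first slot. -/
def dqS {n : ℕ} (A : Fin n → ℕ) (a : Vec n → Vec n → ℂ) : Vec n → Vec n → ℂ :=
  fun q p => mpd A (fun x => a x p) q

/-- Derivative `∂_p^B` of a function `a(q, p)` in the second slot. -/
def dpS {n : ℕ} (B : Fin n → ℕ) (a : Vec n → Vec n → ℂ) : Vec n → Vec n → ℂ :=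
  fun q p => mpd B (fun x => a q x) p

/-- Derivative `∂_q^A` of a function `a(q, p, q')` in the first slot. -/
def d1B {n : ℕ} (A : Fin n → ℕ) (a : Vec n → Vec n → Vec n → ℂ) :
    Vec n → Vec n → Vec n → ℂ :=
  fun q p q' => mpd A (fun x => a x p q') q

/-- Derivative `∂_p^B` of a function `a(q, p, q')` in the second slot. -/
def d2B {n : ℕ} (B : Fin n → ℕ) (a : Vec n → Vec n → Vec n → ℂ) :
    Vec n → Vec n → Vec n → ℂ :=
  fun q p q' => mpd B (fun x => a q x q') p

/-- Derivative `∂_{q'}^{A'}` of a function `a(q, p, q')` in the third slot. -/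
def d3B {n : ℕ} (A' : Fin n → ℕ) (a : Vec n → Vec n → Vec n → ℂ) :
    Vec n → Vec n → Vec n → ℂ :=
  fun q p q' => mpd A' (fun x => a q p x) q'

/-- The admissibility condition for the weight `λ : ℝ → (0,∞)`:
`λ` is positive and `C₀⁻¹ ≤ λ(r)/λ(r') ≤ C₀` whenever `|r - r'| ≤ 1`. -/
def Admissible (lam : ℝ → ℝ) : Prop :=
  (∀ r, 0 < lam r) ∧
  ∃ C > 0, ∀ r r' : ℝ, |r - r'| ≤ 1 → C⁻¹ ≤ lam r / lam r' ∧ lam r / lam r' ≤ C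

/-- The symbol class `S^m_σ(λ)`:  `a` is smooth on `ℝ^{2n}` and for all multiindices
`A = (α₀, α)`, `B = (β₀, β)`,
`|(λ(r)⁻¹∂_θ)^α (λ(r)∂_η)^β ∂_r^{α₀} ∂_ρ^{β₀} a(q,p)| ≤ C ⟨ρ ⊕ λ(r)⁻¹η⟩^{m - σ|B|}`.
(The weights `λ(r)^{±1}` commute with the `θ`- and `η`-derivatives, so the weighted
derivative equals `λ(r)^{|β| - |α|}` times the plain mixed partial derivative.) -/
def IsSymbol {n : ℕ} [NeZero n] (lam : ℝ → ℝ) (m σ : ℝ) (a : Vec n → Vec n → ℂ) : Prop :=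
  ContDiff ℝ (⊤ : ℕ∞) (fun x : Vec n × Vec n => a x.1 x.2) ∧
  ∀ A B : Fin n → ℕ, ∃ C > 0, ∀ q p : Vec n,
    lam (q 0) ^ ((angLen B : ℤ) - (angLen A : ℤ)) * ‖dqS A (dpS B a) q p‖
      ≤ C * jbr (lam (q 0)) p ^ (m - σ * (fullLen B : ℝ))

/-- The seminorm `|a|_{λ : M, m, σ}` on the symbol class `S^m_σ(λ)`. -/
def symSeminorm {n : ℕ} [NeZero n] (lam : ℝ → ℝ) (M : ℕ) (m σ : ℝ)
    (a : Vec n → Vec n → ℂ) : ℝ :=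
  ∑ A : Fin n → Fin (M + 1), ∑ B : Fin n → Fin (M + 1),
    if fullLen (fun i => (A i : ℕ)) + fullLen (fun i => (B i : ℕ)) ≤ M then
      ⨆ q : Vec n, ⨆ p : Vec n,
        jbr (lam (q 0)) p ^ (-m + σ * (fullLen (fun i => (B i : ℕ)) : ℝ)) *
          (lam (q 0) ^ ((angLen (fun i => (B i : ℕ)) : ℤ) - (angLen (fun i => (A i : ℕ)) : ℤ)) *
            ‖dqS (fun i => (A i : ℕ)) (dpS (fun i => (B i : ℕ)) a) q p‖)
    else 0

/-- `λ^t_{jk} := λ(tj + (1-t)k)`. -/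
def lamT (lam : ℝ → ℝ) (t : ℝ) (j k : ℤ) : ℝ := lam (t * j + (1 - t) * k)

/-- The bisymbol class `BS^m_σ(λ; t)`. -/
def IsBisymbol {n : ℕ} [NeZero n] (lam : ℝ → ℝ) (m σ t : ℝ)
    (a : Vec n → Vec n → Vec n → ℂ) : Prop :=
  ContDiff ℝ (⊤ : ℕ∞) (fun x : Vec n × Vec n × Vec n => a x.1 x.2.1 x.2.2) ∧
  ∀ A B A' : Fin n → ℕ, ∃ C > 0, ∀ (j k : ℤ) (q p q' : Vec n),
    |q 0 - (j : ℝ)| ≤ 1 → |q' 0 - (k : ℝ)| ≤ 1 →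
    lamT lam t j k ^ ((angLen B : ℤ) - (angLen A : ℤ) - (angLen A' : ℤ)) *
        ‖d1B A (d2B B (d3B A' a)) q p q'‖
      ≤ C * jbr (lamT lam t j k) p ^ (m - σ * (fullLen B : ℝ))

/-- The seminorm `|a|_{λ : M, m, σ, t}` on `BS^m_σ(λ; t)`. -/
def bisymSeminorm {n : ℕ} [NeZero n] (lam : ℝ → ℝ) (M : ℕ) (m σ t : ℝ)
    (a : Vec n → Vec n → Vec n → ℂ) : ℝ :=
  ∑ A : Fin n → Fin (M + 1), ∑ B : Fin n → Fin (M + 1), ∑ A' : Fin n → Fin (M + 1),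
    if fullLen (fun i => (A i : ℕ)) + fullLen (fun i => (B i : ℕ))
        + fullLen (fun i => (A' i : ℕ)) ≤ M then
      ⨆ j : ℤ, ⨆ k : ℤ, ⨆ q : Vec n, ⨆ p : Vec n, ⨆ q' : Vec n,
        if |q 0 - (j : ℝ)| ≤ 1 ∧ |q' 0 - (k : ℝ)| ≤ 1 then
          jbr (lamT lam t j k) p ^ (-m + σ * (fullLen (fun i => (B i : ℕ)) : ℝ)) *
            (lamT lam t j k ^ ((angLen (fun i => (B i : ℕ)) : ℤ)
                - (angLen (fun i => (A i : ℕ)) : ℤ) - (angLen (fun i => (A' i : ℕ)) : ℤ)) *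
              ‖d1B (fun i => (A i : ℕ)) (d2B (fun i => (B i : ℕ))
                  (d3B (fun i => (A' i : ℕ)) a)) q p q'‖)
        else 0
    else 0

/-- The plain bisymbol class `BS^m_σ(1)` (the case `λ ≡ 1`). -/
def IsBisymbolOne {n : ℕ} [NeZero n] (m σ : ℝ) (a : Vec n → Vec n → Vec n → ℂ) : Prop :=
  ContDiff ℝ (⊤ : ℕ∞) (fun x : Vec n × Vec n × Vec n => a x.1 x.2.1 x.2.2) ∧
  ∀ A B A' : Fin n → ℕ, ∃ C > 0, ∀ q p q' : Vec n,
    ‖d1B A (d2B B (d3B A' a)) q p q'‖ ≤ C * jbr 1 p ^ (m - σ * (fullLen B : ℝ))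

/-- The seminorm `|a|_{M, m, σ}` on `BS^m_σ(1)`. -/
def bisymSeminormOne {n : ℕ} [NeZero n] (M : ℕ) (m σ : ℝ)
    (a : Vec n → Vec n → Vec n → ℂ) : ℝ :=
  ∑ A : Fin n → Fin (M + 1), ∑ B : Fin n → Fin (M + 1), ∑ A' : Fin n → Fin (M + 1),
    if fullLen (fun i => (A i : ℕ)) + fullLen (fun i => (B i : ℕ))
        + fullLen (fun i => (A' i : ℕ)) ≤ M then
      ⨆ q : Vec n, ⨆ p : Vec n, ⨆ q' : Vec n,
        jbr 1 p ^ (-m + σ * (fullLen (fun i => (B i : ℕ)) : ℝ)) *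
          ‖d1B (fun i => (A i : ℕ)) (d2B (fun i => (B i : ℕ))
              (d3B (fun i => (A' i : ℕ)) a)) q p q'‖
    else 0

/-- The oscillatory phase `e^{i p · (q - q')}`. -/
def phase {n : ℕ} (p q q' : Vec n) : ℂ :=
  Complex.exp (Complex.I * ((∑ i, p i * (q i - q' i) : ℝ) : ℂ))

/-- The pseudodifferential operator `Op^g(a)` with bisymbol `a`, as an iterated integral:
`Op^g(a)u(q) = (2π)^{-n} g(q)^{-1/4} ∫ dp ∫ dq' a(q,p,q') e^{ip⋅(q-q')} u(q') g(q')^{1/4}`. -/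
def OpG {n : ℕ} (g : Vec n → ℝ) (a : Vec n → Vec n → Vec n → ℂ) (u : Vec n → ℂ) :
    Vec n → ℂ :=
  fun q => (((2 * Real.pi) ^ (-(n : ℤ)) : ℝ) : ℂ) * ((g q ^ (-(1 : ℝ) / 4) : ℝ) : ℂ) *
    ∫ p : Vec n, ∫ q' : Vec n,
      a q p q' * phase p q q' * u q' * ((g q' ^ ((1 : ℝ) / 4) : ℝ) : ℂ)

/-- The pseudodifferential operator `Op(a) = Op^1(a)` with bisymbol `a`. -/
def Op {n : ℕ} (a : Vec n → Vec n → Vec n → ℂ) (u : Vec n → ℂ) : Vec n → ℂ :=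
  fun q => (((2 * Real.pi) ^ (-(n : ℤ)) : ℝ) : ℂ) *
    ∫ p : Vec n, ∫ q' : Vec n, a q p q' * phase p q q' * u q'

/-- The `t`-quantization `Op^{g,t}(a)` of a symbol `a`. -/
def OpSt {n : ℕ} (g : Vec n → ℝ) (t : ℝ) (a : Vec n → Vec n → ℂ) (u : Vec n → ℂ) :
    Vec n → ℂ :=
  OpG g (fun q p q' => a (t • q + (1 - t) • q') p) u

/-- The quantization `Op(b)` of a symbol `b` (the case `t = 1`, `g ≡ 1`). -/
def OpSym {n : ℕ} (b : Vec n → Vec n → ℂ) (u : Vec n → ℂ) : Vec n → ℂ :=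
  Op (fun q p _ => b q p) u

/-- The `L²(g^{1/2}dq)` norm. -/
def L2g {n : ℕ} (g : Vec n → ℝ) (f : Vec n → ℂ) : ℝ :=
  Real.sqrt (∫ q : Vec n, ‖f q‖ ^ 2 * Real.sqrt (g q))

/-- The `L²(dq)` norm. -/
def L2 {n : ℕ} (f : Vec n → ℂ) : ℝ :=
  Real.sqrt (∫ q : Vec n, ‖f q‖ ^ 2)

end

noncomputable section

/-- The semiclassical quantization `Op_ħ(a) := Op(a(q, ħp, q'))`. -/
def Oph {n : ℕ} (h : ℝ) (a : Vec n → Vec n → Vec n → ℂ) (u : Vec n → ℂ) : Vec n → ℂ :=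
  Op (fun q p q' => a q (h • p) q') u

end

noncomputable section

section DirectionalDerivatives

variable {E ι : Type*} [NormedAddCommGroup E] [NormedSpace ℝ E]

/-- The derivative of `f` in the direction `w`. -/
def dirDeriv (w : E) (f : E → ℂ) : E → ℂ := fun z => fderiv ℝ f z w

/-- Successive directional derivatives along a list of directions. -/
def listDeriv (v : ι → E) : List ι → (E → ℂ) → E → ℂ
  | [], f => f
  | i :: l, f => listDeriv v l (dirDeriv (v i) f)

/-- The composition of the operators `1 + ∂_{v i}` for `i` in a list. -/
def onePlusDeriv (v : ι → E) : List ι → (E → ℂ) → E → ℂ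
  | [], f => f
  | i :: l, f => onePlusDeriv v l (fun z => f z + dirDeriv (v i) f z)

/-- Smooth functions all of whose derivatives along `v` are dominated by multiples of `ω`. -/
def SymbolClass (v : ι → E) (ω : E → ℝ) (f : E → ℂ) : Prop :=
  ContDiff ℝ (⊤ : ℕ∞) f ∧ ∀ l : List ι, ∃ C : ℝ, ∀ z, ‖listDeriv v l f z‖ ≤ C * ω z

/-- The derivatives of `f` along `v` of order at most `k` are dominated by `ω`. -/
def DerivBound (v : ι → E) (k : ℕ) (ω : E → ℝ) (f : E → ℂ) : Prop :=
  ContDiff ℝ (⊤ : ℕ∞) f ∧ ∀ l : List ι, l.length ≤ k → ∀ z, ‖listDeriv v l f z‖ ≤ ω z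

variable {v : ι → E} {f g : E → ℂ} {ω ω' : E → ℝ} {k : ℕ}

theorem ContDiff.dirDeriv (hf : ContDiff ℝ (⊤ : ℕ∞) f) (w : E) :
    ContDiff ℝ (⊤ : ℕ∞) (dirDeriv w f) := by
  unfold _root_.dirDeriv
  exact (hf.fderiv_right (m := (⊤ : ℕ∞)) (by simp)).clm_apply contDiff_const

theorem ContDiff.differentiable_of_smooth (hf : ContDiff ℝ (⊤ : ℕ∞) f) : Differentiable ℝ f :=
  hf.differentiable (by simp)

theorem dirDeriv_add (hf : ContDiff ℝ (⊤ : ℕ∞) f) (hg : ContDiff ℝ (⊤ : ℕ∞) g) (w : E) :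
    dirDeriv w (fun z => f z + g z) = fun z => dirDeriv w f z + dirDeriv w g z := by
  funext z
  unfold dirDeriv
  rw [fderiv_fun_add hf.differentiable_of_smooth.differentiableAt
    hg.differentiable_of_smooth.differentiableAt]
  rfl

theorem dirDeriv_mul (hf : ContDiff ℝ (⊤ : ℕ∞) f) (hg : ContDiff ℝ (⊤ : ℕ∞) g) (w : E) :
    dirDeriv w (fun z => f z * g z)
      = fun z => dirDeriv w f z * g z + f z * dirDeriv w g z := by
  funext z
  unfold dirDeriv
  rw [fderiv_fun_mul hf.differentiable_of_smooth.differentiableAt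
    hg.differentiable_of_smooth.differentiableAt]
  simp [mul_comm, add_comm]

theorem dirDeriv_comm (hf : ContDiff ℝ (⊤ : ℕ∞) f) (w w' : E) :
    dirDeriv w (dirDeriv w' f) = dirDeriv w' (dirDeriv w f) := by
  have key : ∀ a b z, dirDeriv a (dirDeriv b f) z = fderiv ℝ (fderiv ℝ f) z a b := by
    intro a b z
    unfold dirDeriv
    rw [fderiv_clm_apply]
    · simp
    · exact ((hf.fderiv_right (m := (⊤ : ℕ∞)) (by simp)).differentiable
        (by simp)).differentiableAt
    · exact differentiableAt_const _
  funext z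
  rw [key, key]
  refine (ContDiffAt.isSymmSndFDerivAt (n := (⊤ : ℕ∞)) hf.contDiffAt ?_) _ _
  rw [minSmoothness_of_isRCLikeNormedField]
  exact WithTop.coe_le_coe.2 (le_top : (2 : ℕ∞) ≤ ⊤)

theorem ContDiff.listDeriv (v : ι → E) (l : List ι) (hf : ContDiff ℝ (⊤ : ℕ∞) f) :
    ContDiff ℝ (⊤ : ℕ∞) (listDeriv v l f) := by
  induction l generalizing f with
  | nil => exact hf
  | cons i l ih => exact ih (hf.dirDeriv _)

theorem listDeriv_perm {l l' : List ι} (h : l.Perm l') (hf : ContDiff ℝ (⊤ : ℕ∞) f) :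
    listDeriv v l f = listDeriv v l' f := by
  induction h generalizing f with
  | nil => rfl
  | cons i _ ih => exact ih (hf.dirDeriv _)
  | swap i j l => simp only [listDeriv]; rw [dirDeriv_comm hf]
  | trans _ _ ih ih' => exact (ih hf).trans (ih' hf)

theorem listDeriv_add (l : List ι) (hf : ContDiff ℝ (⊤ : ℕ∞) f) (hg : ContDiff ℝ (⊤ : ℕ∞) g) :
    listDeriv v l (fun z => f z + g z) = fun z => listDeriv v l f z + listDeriv v l g z := by
  induction l generalizing f g with
  | nil => rfl
  | cons i l ih =>
    simp only [listDeriv]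
    rw [dirDeriv_add hf hg, ih (hf.dirDeriv _) (hg.dirDeriv _)]

theorem listDeriv_append (l l' : List ι) :
    listDeriv v (l ++ l') f = listDeriv v l' (listDeriv v l f) := by
  induction l generalizing f with
  | nil => rfl
  | cons i l ih => exact ih

namespace SymbolClass

theorem bound (hf : SymbolClass v ω f) : ∃ C : ℝ, ∀ z, ‖f z‖ ≤ C * ω z := hf.2 []

theorem dirDeriv (hf : SymbolClass v ω f) (i : ι) : SymbolClass v ω (dirDeriv (v i) f) :=
  ⟨hf.1.dirDeriv _, fun l => hf.2 (i :: l)⟩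

theorem add (hf : SymbolClass v ω f) (hg : SymbolClass v ω g) :
    SymbolClass v ω (fun z => f z + g z) := by
  refine ⟨hf.1.add hg.1, fun l => ?_⟩
  obtain ⟨C, hC⟩ := hf.2 l
  obtain ⟨D, hD⟩ := hg.2 l
  refine ⟨C + D, fun z => ?_⟩
  rw [listDeriv_add l hf.1 hg.1, add_mul]
  exact (norm_add_le _ _).trans (add_le_add (hC z) (hD z))

theorem onePlusDeriv (hf : SymbolClass v ω f) (l : List ι) :
    SymbolClass v ω (onePlusDeriv v l f) := by
  induction l generalizing f with
  | nil => exact hf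
  | cons i l ih => exact ih (hf.add (hf.dirDeriv i))

theorem mul (hf : SymbolClass v ω f) (hg : SymbolClass v ω' g) :
    SymbolClass v (fun z => ω z * ω' z) (fun z => f z * g z) := by
  refine ⟨hf.1.mul hg.1, fun l => ?_⟩
  induction l generalizing f g with
  | nil =>
    obtain ⟨C, hC⟩ := hf.bound
    obtain ⟨D, hD⟩ := hg.bound
    refine ⟨C * D, fun z => ?_⟩
    simp only [listDeriv, norm_mul]
    calc ‖f z‖ * ‖g z‖ ≤ (C * ω z) * (D * ω' z) :=
          mul_le_mul (hC z) (hD z) (norm_nonneg _) ((norm_nonneg _).trans (hC z))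
      _ = _ := by ring
  | cons i l ih =>
    obtain ⟨C, hC⟩ := ih (hf.dirDeriv i) hg
    obtain ⟨D, hD⟩ := ih hf (hg.dirDeriv i)
    refine ⟨C + D, fun z => ?_⟩
    simp only [listDeriv]
    rw [dirDeriv_mul hf.1 hg.1,
      listDeriv_add l ((hf.1.dirDeriv _).mul hg.1) (hf.1.mul (hg.1.dirDeriv _)), add_mul]
    exact (norm_add_le _ _).trans (add_le_add (hC z) (hD z))

theorem mono (hf : SymbolClass v ω f) (h : ∀ z, 0 ≤ ω z ∧ ω z ≤ ω' z) : SymbolClass v ω' f := by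
  refine ⟨hf.1, fun l => ?_⟩
  obtain ⟨C, hC⟩ := hf.2 l
  refine ⟨|C|, fun z => (hC z).trans ?_⟩
  calc C * ω z ≤ |C| * ω z := mul_le_mul_of_nonneg_right (le_abs_self C) (h z).1
    _ ≤ _ := mul_le_mul_of_nonneg_left (h z).2 (abs_nonneg C)

theorem prod {κ : Type*} (s : Finset κ) {F : κ → E → ℂ} {W : κ → E → ℝ}
    (h : ∀ j, SymbolClass v (W j) (F j)) :
    SymbolClass v (fun z => ∏ j ∈ s, W j z) (fun z => ∏ j ∈ s, F j z) := by
  induction s using Finset.induction_on with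
  | empty =>
    refine ⟨by simpa using contDiff_const, fun l => ?_⟩
    have : ∀ l : List ι, ∀ c : ℂ, ∃ C : ℝ, ∀ z, ‖listDeriv v l (fun _ => c) z‖ ≤ C := by
      intro l
      induction l with
      | nil => exact fun c => ⟨‖c‖, fun z => le_rfl⟩
      | cons i l ih =>
        intro c
        have : _root_.dirDeriv (v i) (fun _ : E => c) = fun _ => 0 := by
          funext z; simp [_root_.dirDeriv]
        simpa only [listDeriv, this] using ih 0
    simpa using this l 1
  | insert j s hj ih =>
    simpa only [Finset.prod_insert hj] using (h j).mul ih

theorem exists_derivBound [Finite ι] (hf : SymbolClass v ω f) (hω : ∀ z, 0 ≤ ω z) (k : ℕ) :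
    ∃ C : ℝ, 0 ≤ C ∧ DerivBound v k (fun z => C * ω z) f := by
  choose C hC using hf.2
  obtain ⟨D, hD⟩ := ((List.finite_length_le ι k).image C).bddAbove
  refine ⟨max D 0, le_max_right _ _, hf.1, fun l hl z => (hC l z).trans ?_⟩
  exact mul_le_mul_of_nonneg_right
    ((hD (Set.mem_image_of_mem _ hl)).trans (le_max_left _ _)) (hω z)

end SymbolClass

namespace DerivBound

theorem mono_order {k' : ℕ} (hf : DerivBound v k ω f) (h : k' ≤ k) : DerivBound v k' ω f :=
  ⟨hf.1, fun l hl => hf.2 l (hl.trans h)⟩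

theorem congr (hf : DerivBound v k ω f) (h : ∀ z, ω z = ω' z) : DerivBound v k ω' f :=
  ⟨hf.1, fun l hl z => (hf.2 l hl z).trans (h z).le⟩

theorem bound (hf : DerivBound v k ω f) (z : E) : ‖f z‖ ≤ ω z := hf.2 [] (Nat.zero_le _) z

theorem dirDeriv (hf : DerivBound v (k + 1) ω f) (i : ι) :
    DerivBound v k ω (dirDeriv (v i) f) :=
  ⟨hf.1.dirDeriv _, fun l hl => hf.2 (i :: l) (by simpa using hl)⟩

theorem add (hf : DerivBound v k ω f) (hg : DerivBound v k ω' g) :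
    DerivBound v k (fun z => ω z + ω' z) (fun z => f z + g z) := by
  refine ⟨hf.1.add hg.1, fun l hl z => ?_⟩
  rw [listDeriv_add l hf.1 hg.1]
  exact (norm_add_le _ _).trans (add_le_add (hf.2 l hl z) (hg.2 l hl z))

theorem onePlusDeriv (l : List ι) (hf : DerivBound v (k + l.length) ω f) :
    DerivBound v k (fun z => 2 ^ l.length * ω z) (onePlusDeriv v l f) := by
  induction l generalizing f ω with
  | nil => simpa [_root_.onePlusDeriv] using hf
  | cons i l ih =>
    have h1 : DerivBound v (k + l.length + 1) ω f := hf.mono_order (by simp [add_assoc])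
    refine (ih ((h1.mono_order (Nat.le_succ _)).add (h1.dirDeriv i))).congr fun z => ?_
    simp only [List.length_cons]; ring

theorem mul (hf : DerivBound v k ω f) (hg : DerivBound v k ω' g) :
    DerivBound v k (fun z => 2 ^ k * (ω z * ω' z)) (fun z => f z * g z) := by
  refine ⟨hf.1.mul hg.1, fun l hl z => ?_⟩
  have key : ∀ l : List ι, ∀ m : ℕ, ∀ f g, DerivBound v m ω f → DerivBound v m ω' g →
      l.length ≤ m → ‖listDeriv v l (fun z => f z * g z) z‖ ≤ 2 ^ l.length * (ω z * ω' z) := by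
    intro l
    induction l with
    | nil =>
      intro m f g hf hg _
      simp only [listDeriv, norm_mul, List.length_nil, pow_zero, one_mul]
      exact mul_le_mul (hf.bound z) (hg.bound z) (norm_nonneg _)
        ((norm_nonneg _).trans (hf.bound z))
    | cons i l ih =>
      intro m f g hf hg hl
      obtain ⟨m, rfl⟩ : ∃ m', m = m' + 1 := ⟨m - 1, by simp at hl; omega⟩
      have hl' : l.length ≤ m := by simpa using hl
      simp only [listDeriv]
      rw [dirDeriv_mul hf.1 hg.1,
        listDeriv_add l ((hf.1.dirDeriv _).mul hg.1) (hf.1.mul (hg.1.dirDeriv _))]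
      have h1 := ih m _ _ (hf.dirDeriv i) (hg.mono_order (Nat.le_succ _)) hl'
      have h2 := ih m _ _ (hf.mono_order (Nat.le_succ _)) (hg.dirDeriv i) hl'
      refine (norm_add_le _ _).trans ((add_le_add h1 h2).trans (le_of_eq ?_))
      simp only [List.length_cons]; ring
  refine (key l k f g hf hg hl).trans ?_
  refine mul_le_mul_of_nonneg_right (pow_le_pow_right₀ (by norm_num) hl) ?_
  exact mul_nonneg ((norm_nonneg _).trans (hf.bound z)) ((norm_nonneg _).trans (hg.bound z))

end DerivBound

end DirectionalDerivatives

section ExponentialKernel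

/-- The fundamental solution of `1 + d/dt` supported on the positive half line. -/
def halfLineExp : ℝ → ℝ := (Set.Ioi 0).indicator fun t => Real.exp (-t)

/-- The fundamental solution of `∏ i, (1 + ∂_i)` supported on the positive orthant. -/
def orthantExp {n : ℕ} (s : Vec n) : ℝ := ∏ i, halfLineExp (s i)

/-- The plane wave `e^{i s ⋅ w}`. -/
def wave {n : ℕ} (s w : Vec n) : ℂ := Complex.exp (Complex.I * ((∑ i, s i * w i : ℝ) : ℂ))

/-- The Fourier transform of `orthantExp`. -/
def resolventSymbol {n : ℕ} (w : Vec n) : ℂ := ∏ i, (1 - Complex.I * (w i : ℂ))⁻¹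

variable {n : ℕ}

theorem halfLineExp_nonneg (t : ℝ) : 0 ≤ halfLineExp t :=
  Set.indicator_nonneg (fun _ _ => (Real.exp_pos _).le) t

theorem halfLineExp_le_one (t : ℝ) : halfLineExp t ≤ 1 := by
  refine Set.indicator_le' (f := fun t => Real.exp (-t)) (g := fun _ => (1 : ℝ)) ?_ ?_ t
  · intro t ht
    exact Real.exp_le_one_iff.2 (by simpa using (le_of_lt ht : (0 : ℝ) ≤ t))
  · intro t _; exact zero_le_one

theorem measurable_halfLineExp : Measurable halfLineExp :=
  (by fun_prop : Measurable fun t : ℝ => Real.exp (-t)).indicator measurableSet_Ioi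

theorem integrable_halfLineExp : Integrable halfLineExp := by
  unfold halfLineExp
  rw [integrable_indicator_iff measurableSet_Ioi]
  exact integrableOn_exp_neg_Ioi 0

theorem orthantExp_nonneg (s : Vec n) : 0 ≤ orthantExp s :=
  Finset.prod_nonneg fun _ _ => halfLineExp_nonneg _

theorem orthantExp_le_one (s : Vec n) : orthantExp s ≤ 1 :=
  Finset.prod_le_one (fun _ _ => halfLineExp_nonneg _) fun _ _ => halfLineExp_le_one _

@[fun_prop]
theorem measurable_orthantExp : Measurable (orthantExp (n := n)) :=
  Finset.measurable_prod _ fun i _ => measurable_halfLineExp.comp (measurable_pi_apply i)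

theorem integrable_orthantExp : Integrable (orthantExp (n := n)) :=
  Integrable.fintype_prod (f := fun _ : Fin n => halfLineExp) fun _ => integrable_halfLineExp

theorem integral_halfLineExp : ∫ t, halfLineExp t = 1 := by
  unfold halfLineExp
  rw [integral_indicator measurableSet_Ioi, integral_exp_neg_Ioi_zero]

theorem integral_orthantExp : ∫ s : Vec n, orthantExp s = 1 := by
  unfold orthantExp
  rw [integral_fintype_prod_volume_eq_prod (f := fun (_ : Fin n) t => halfLineExp t)]
  simp [integral_halfLineExp]

@[fun_prop]
theorem Continuous.wave {X : Type*} [TopologicalSpace X] {f g : X → Vec n}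
    (hf : Continuous f) (hg : Continuous g) : Continuous fun x => wave (f x) (g x) := by
  unfold _root_.wave
  fun_prop

theorem norm_wave (s w : Vec n) : ‖wave s w‖ = 1 := by
  unfold wave
  rw [mul_comm, Complex.norm_exp_ofReal_mul_I]

theorem wave_add_left (s s' w : Vec n) : wave (s + s') w = wave s w * wave s' w := by
  unfold wave
  rw [← Complex.exp_add, ← mul_add, ← Complex.ofReal_add, ← Finset.sum_add_distrib]
  simp [add_mul]

theorem wave_comm (s w : Vec n) : wave s w = wave w s := by
  simp [wave, mul_comm]

theorem wave_add_right (s w w' : Vec n) : wave s (w + w') = wave s w * wave s w' := by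
  rw [wave_comm, wave_add_left, wave_comm w, wave_comm w']

theorem wave_neg_right (s w : Vec n) : wave s (-w) = wave (-s) w := by
  simp [wave]

theorem phase_eq_wave (p q q' : Vec n) : phase p q q' = wave p q * wave p (-q') := by
  rw [← wave_add_right]
  simp [phase, wave, sub_eq_add_neg]

theorem integral_orthantExp_mul_wave (w : Vec n) :
    ∫ s : Vec n, (orthantExp s : ℂ) * wave s w = resolventSymbol w := by
  have h1 : ∀ s : Vec n, (orthantExp s : ℂ) * wave s w
      = ∏ i, ((halfLineExp (s i) : ℂ) * Complex.exp (Complex.I * (w i : ℂ) * (s i : ℂ))) := by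
    intro s
    rw [Finset.prod_mul_distrib, ← Complex.exp_sum]
    simp only [orthantExp, wave, Complex.ofReal_prod, Complex.ofReal_sum, Complex.ofReal_mul,
      Finset.mul_sum]
    congr 2
    exact Finset.sum_congr rfl fun i _ => by ring
  simp_rw [h1]
  rw [integral_fintype_prod_volume_eq_prod
    (f := fun i t => (halfLineExp t : ℂ) * Complex.exp (Complex.I * (w i : ℂ) * (t : ℂ)))]
  refine Finset.prod_congr rfl fun i _ => ?_
  have h2 : ∀ t : ℝ, (halfLineExp t : ℂ) * Complex.exp (Complex.I * (w i : ℂ) * (t : ℂ))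
      = (Set.Ioi 0).indicator
        (fun t : ℝ => Complex.exp ((-1 + Complex.I * (w i : ℂ)) * (t : ℂ))) t := by
    intro t
    unfold halfLineExp
    by_cases ht : t ∈ Set.Ioi (0 : ℝ)
    · simp only [Set.indicator_of_mem ht]
      rw [Complex.ofReal_exp, ← Complex.exp_add]
      congr 1
      push_cast; ring
    · simp only [Set.indicator_of_notMem ht]
      simp
  simp_rw [h2]
  rw [integral_indicator measurableSet_Ioi, integral_exp_mul_complex_Ioi (by simp)]
  have h3 : (1 - Complex.I * (w i : ℂ)) = -(-1 + Complex.I * (w i : ℂ)) := by ring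
  rw [h3]
  simp [neg_div, ← inv_neg]

theorem norm_resolventSymbol (w : Vec n) :
    ‖resolventSymbol w‖ = ∏ i, (Real.sqrt (1 + w i ^ 2))⁻¹ := by
  unfold resolventSymbol
  rw [norm_prod]
  refine Finset.prod_congr rfl fun i _ => ?_
  rw [norm_inv, Complex.norm_def, Complex.normSq_apply]
  congr 2
  simp; ring

theorem norm_sq_resolventSymbol (w : Vec n) :
    ‖resolventSymbol w‖ ^ 2 = ∏ i, (1 + w i ^ 2)⁻¹ := by
  rw [norm_resolventSymbol, ← Finset.prod_pow]
  refine Finset.prod_congr rfl fun i _ => ?_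
  rw [inv_pow, Real.sq_sqrt (by positivity)]

theorem continuous_resolventSymbol : Continuous (resolventSymbol (n := n)) := by
  refine continuous_finsetProd _ fun i _ => Continuous.inv₀ (by fun_prop) fun w h => ?_
  simpa using congrArg Complex.re h

theorem integrable_norm_sq_resolventSymbol :
    Integrable fun w : Vec n => ‖resolventSymbol w‖ ^ 2 := by
  simp_rw [norm_sq_resolventSymbol]
  exact Integrable.fintype_prod (f := fun _ : Fin n => fun t : ℝ => (1 + t ^ 2)⁻¹)
    fun _ => integrable_inv_one_add_sq

theorem norm_resolventSymbol_neg (w : Vec n) : ‖resolventSymbol (-w)‖ = ‖resolventSymbol w‖ := by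
  simp [norm_resolventSymbol]

end ExponentialKernel

section Representation

variable {E ι : Type*} [NormedAddCommGroup E] [NormedSpace ℝ E]

theorem integral_halfLineExp_mul {φ φ' : ℝ → ℂ} (hφ : ∀ t, HasDerivAt φ (φ' t) t)
    {C : ℝ} (hC : ∀ t, ‖φ t‖ ≤ C) (hcont : Continuous φ') {C' : ℝ} (hC' : ∀ t, ‖φ' t‖ ≤ C') :
    ∫ t, (halfLineExp t : ℂ) * (φ t - φ' t) = φ 0 := by
  have hφc : Continuous φ := continuous_iff_continuousAt.2 fun t => (hφ t).continuousAt
  have h1 : ∀ t : ℝ, (halfLineExp t : ℂ) * (φ t - φ' t)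
      = (Set.Ioi 0).indicator (fun t : ℝ => (Real.exp (-t) : ℂ) * (φ t - φ' t)) t := by
    intro t
    by_cases ht : t ∈ Set.Ioi (0 : ℝ)
    · simp only [halfLineExp, Set.indicator_of_mem ht]
    · simp only [halfLineExp, Set.indicator_of_notMem ht]; simp
  simp_rw [h1]
  rw [integral_indicator measurableSet_Ioi]
  have hd : ∀ t : ℝ, HasDerivAt (fun t : ℝ => -((Real.exp (-t) : ℂ) * φ t))
      ((Real.exp (-t) : ℂ) * (φ t - φ' t)) t := by
    intro t
    have h2 : HasDerivAt (fun t : ℝ => (Real.exp (-t) : ℂ)) ((Real.exp (-t) * -1 : ℝ) : ℂ) t :=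
      ((hasDerivAt_neg t).exp).ofReal_comp
    refine (h2.mul (hφ t)).neg.congr_deriv ?_
    push_cast; ring
  have hint : IntegrableOn (fun t : ℝ => (Real.exp (-t) : ℂ) * (φ t - φ' t)) (Set.Ioi 0) := by
    refine Integrable.mono' ((integrableOn_exp_neg_Ioi 0).mul_const (C + C'))
      (by fun_prop) (Filter.Eventually.of_forall fun t => ?_)
    rw [norm_mul, Complex.norm_real, Real.norm_of_nonneg (Real.exp_pos _).le]
    exact mul_le_mul_of_nonneg_left ((norm_sub_le _ _).trans (add_le_add (hC t) (hC' t)))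
      (Real.exp_pos _).le
  have hlim : Filter.Tendsto (fun t : ℝ => -((Real.exp (-t) : ℂ) * φ t)) Filter.atTop (nhds 0) := by
    refine squeeze_zero_norm (a := fun t => Real.exp (-t) * C) (fun t => ?_) ?_
    · rw [norm_neg, norm_mul, Complex.norm_real, Real.norm_of_nonneg (Real.exp_pos _).le]
      exact mul_le_mul_of_nonneg_left (hC t) (Real.exp_pos _).le
    · simpa using (Real.tendsto_exp_neg_atTop_nhds_zero.mul_const C)
  rw [integral_Ioi_of_hasDerivAt_of_tendsto (hd 0).continuousAt.continuousWithinAt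
    (fun t _ => hd t) hint hlim]
  simp

theorem eq_integral_halfLineExp {v : ι → E} {f : E → ℂ} (hf : SymbolClass v (fun _ => 1) f)
    (i : ι) (z : E) :
    f z = ∫ t, (halfLineExp t : ℂ) * (f (z - t • v i) + dirDeriv (v i) f (z - t • v i)) := by
  obtain ⟨C, hC⟩ := hf.bound
  obtain ⟨C', hC'⟩ := (hf.dirDeriv i).bound
  have hd : ∀ t : ℝ, HasDerivAt (fun t : ℝ => f (z - t • v i))
      (-dirDeriv (v i) f (z - t • v i)) t := by
    intro t
    have h1 : HasDerivAt (fun t : ℝ => z - t • v i) (-v i) t := by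
      simpa using ((hasDerivAt_id t).smul_const (v i)).const_sub z
    have h2 := (hf.1.differentiable_of_smooth (z - t • v i)).hasFDerivAt.comp_hasDerivAt t h1
    refine h2.congr_deriv ?_
    simp [dirDeriv]
  have h := integral_halfLineExp_mul hd (C := C) (fun t => by simpa using hC (z - t • v i))
    ((hf.1.dirDeriv (v i)).continuous.comp (by fun_prop : Continuous fun t : ℝ => z - t • v i)).neg
    (C' := C') (fun t => by simpa using hC' (z - t • v i))
  simp only [sub_neg_eq_add, zero_smul, sub_zero] at h
  exact h.symm

theorem eq_integral_orthantExp {v : ι → E} {m : ℕ} (j : Fin m → ι) {f : E → ℂ}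
    (hf : SymbolClass v (fun _ => 1) f) (z : E) :
    f z = ∫ s : Vec m, (orthantExp s : ℂ) *
      onePlusDeriv v (List.ofFn j) f (z - ∑ i, s i • v (j i)) := by
  induction m generalizing f z with
  | zero => simp [onePlusDeriv, orthantExp, integral_unique, measureReal_def, volume_pi]
  | succ m ih =>
    have hT : SymbolClass v (fun _ => 1) (fun z => f z + dirDeriv (v (j 0)) f z) :=
      hf.add (hf.dirDeriv _)
    set F := onePlusDeriv v (List.ofFn j) f with hF
    have hFs : SymbolClass v (fun _ => 1) F := hf.onePlusDeriv _
    have hFeq : onePlusDeriv v (List.ofFn fun i : Fin m => j i.succ)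
        (fun z => f z + dirDeriv (v (j 0)) f z) = F := by
      rw [hF, List.ofFn_succ]; rfl
    obtain ⟨C, hC⟩ := hFs.bound
    have hFc : Continuous F := hFs.1.continuous
    rw [eq_integral_halfLineExp hf (j 0) z]
    have h1 : ∀ t : ℝ, f (z - t • v (j 0)) + dirDeriv (v (j 0)) f (z - t • v (j 0))
        = ∫ s : Vec m, (orthantExp s : ℂ) *
          F (z - t • v (j 0) - ∑ i, s i • v (j i.succ)) := by
      intro t
      have := ih (fun i => j i.succ) hT (z - t • v (j 0))
      rwa [hFeq] at this
    simp_rw [h1, ← integral_const_mul]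
    rw [← (volume_preserving_piFinSuccAbove (fun _ : Fin (m + 1) => ℝ) 0).symm.integral_comp'
      (g := fun s : Vec (m + 1) => (orthantExp s : ℂ) * F (z - ∑ i, s i • v (j i)))]
    have h2 : ∀ p : ℝ × Vec m, (fun s : Vec (m + 1) =>
        (orthantExp s : ℂ) * F (z - ∑ i, s i • v (j i)))
        ((MeasurableEquiv.piFinSuccAbove (fun _ : Fin (m + 1) => ℝ) 0).symm p)
        = (halfLineExp p.1 : ℂ) * ((orthantExp p.2 : ℂ) *
          F (z - p.1 • v (j 0) - ∑ i, p.2 i • v (j i.succ))) := by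
      intro p
      simp [MeasurableEquiv.piFinSuccAbove, orthantExp, Fin.prod_univ_succ, Fin.sum_univ_succ,
        mul_assoc, sub_sub, Fin.insertNthEquiv]
    simp_rw [h2]
    rw [Measure.volume_eq_prod, integral_prod]
    have hm : Integrable (fun p : ℝ × Vec m => halfLineExp p.1 * orthantExp p.2) :=
      integrable_halfLineExp.mul_prod integrable_orthantExp
    refine Integrable.mono' (hm.mul_const C) ?_ (Filter.Eventually.of_forall fun p => ?_)
    · refine Measurable.aestronglyMeasurable ?_
      refine Measurable.mul (Complex.measurable_ofReal.comp
        (measurable_halfLineExp.comp measurable_fst)) (Measurable.mul ?_ ?_)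
      · exact Complex.measurable_ofReal.comp (measurable_orthantExp.comp measurable_snd)
      · exact (hFc.comp (by fun_prop)).measurable
    · rw [norm_mul, norm_mul, Complex.norm_real, Complex.norm_real,
        Real.norm_of_nonneg (halfLineExp_nonneg _), Real.norm_of_nonneg (orthantExp_nonneg _),
        ← mul_assoc]
      exact mul_le_mul_of_nonneg_left (by simpa using hC _)
        (mul_nonneg (halfLineExp_nonneg _) (orthantExp_nonneg _))

end Representation

section Plancherel

variable {n : ℕ}

theorem sq_lintegral_mul_le {α : Type*} [MeasurableSpace α] {μ : Measure α}
    {ω h : α → ENNReal} (hω : AEMeasurable ω μ) (hh : AEMeasurable h μ) :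
    (∫⁻ x, ω x * h x ∂μ) ^ 2 ≤ (∫⁻ x, ω x ∂μ) * ∫⁻ x, ω x * h x ^ 2 ∂μ := by
  have h2 : ∀ x : ENNReal, (x ^ (1 / 2 : ℝ)) ^ (2 : ℝ) = x := fun x => by
    rw [← ENNReal.rpow_mul]; norm_num
  have hsq : ∀ x : ENNReal, x ^ (1 / 2 : ℝ) * x ^ (1 / 2 : ℝ) = x := fun x => by
    rw [← ENNReal.rpow_add_of_nonneg _ _ (by norm_num) (by norm_num)]; norm_num
  have hω' : AEMeasurable (fun x => ω x ^ (1 / 2 : ℝ)) μ := hω.pow_const _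
  have key := ENNReal.lintegral_mul_le_Lp_mul_Lq μ Real.HolderConjugate.two_two
    hω' (hω'.mul hh)
  have e1 : ∀ x, ((fun x => ω x ^ (1 / 2 : ℝ)) * ((fun x => ω x ^ (1 / 2 : ℝ)) * h)) x
      = ω x * h x := fun x => by
    simp only [Pi.mul_apply]; rw [← mul_assoc, hsq]
  have e2 : ∀ x, ((fun x => ω x ^ (1 / 2 : ℝ)) * h) x ^ (2 : ℝ) = ω x * h x ^ 2 := fun x => by
    simp only [Pi.mul_apply]
    rw [ENNReal.mul_rpow_of_nonneg _ _ (by norm_num), h2, ENNReal.rpow_two]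
  simp only [e1, e2, h2] at key
  calc _ ≤ ((∫⁻ x, ω x ∂μ) ^ (1 / 2 : ℝ) * (∫⁻ x, ω x * h x ^ 2 ∂μ) ^ (1 / 2 : ℝ)) ^ 2 :=
        pow_le_pow_left₀ zero_le key 2
    _ = _ := by
        rw [mul_pow, ← ENNReal.rpow_two, h2, ← ENNReal.rpow_two, h2]

theorem integrable_gaussian_pi {b : ℝ} (hb : 0 < b) :
    Integrable fun ξ : Vec n => Real.exp (-b * ∑ i, ξ i ^ 2) := by
  have := Integrable.fintype_prod (f := fun _ : Fin n => fun t : ℝ => Real.exp (-b * t ^ 2))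
    (μ := fun _ => volume) fun _ => integrable_exp_neg_mul_sq hb
  simp only [← Real.exp_sum, ← Finset.mul_sum] at this
  exact this

theorem integral_gaussian_pi (b : ℝ) :
    ∫ ξ : Vec n, Real.exp (-b * ∑ i, ξ i ^ 2) = √(π / b) ^ n := by
  have := integral_fintype_prod_volume_eq_prod
    (f := fun (_ : Fin n) (t : ℝ) => Real.exp (-b * t ^ 2))
  simp only [← Real.exp_sum, ← Finset.mul_sum, integral_gaussian, Finset.prod_const,
    Finset.card_univ, Fintype.card_fin] at this
  exact this

theorem norm_integral_gaussian_mul_wave {b : ℝ} (hb : 0 < b) (x : Vec n) :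
    ‖∫ ξ : Vec n, (Real.exp (-b * ∑ i, ξ i ^ 2) : ℂ) * wave ξ x‖
      = √(π / b) ^ n * Real.exp (-(4 * b)⁻¹ * ∑ i, x i ^ 2) := by
  have h1 : ∀ ξ : Vec n, (Real.exp (-b * ∑ i, ξ i ^ 2) : ℂ) * wave ξ x
      = Complex.exp (-(b : ℂ) * ∑ i, (ξ i : ℂ) ^ 2 + ∑ i, (Complex.I * (x i : ℂ)) * (ξ i : ℂ)) := by
    intro ξ
    rw [wave, Complex.ofReal_exp, ← Complex.exp_add]
    congr 1
    push_cast
    rw [Finset.mul_sum Finset.univ _ Complex.I]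
    congr 1
    exact Finset.sum_congr rfl fun i _ => by ring
  simp_rw [h1]
  rw [GaussianFourier.integral_cexp_neg_mul_sum_add (by simpa using hb), norm_mul]
  congr 1
  · rw [← Complex.ofReal_div, Complex.norm_cpow_eq_rpow_re_of_pos (by positivity),
      Real.sqrt_eq_rpow, ← Real.rpow_natCast, ← Real.rpow_mul (by positivity)]
    congr 1
    simp
    ring
  · rw [Complex.norm_exp]
    congr 1
    have : (∑ i, (Complex.I * (x i : ℂ)) ^ 2) / (4 * (b : ℂ))
        = ((-(4 * b)⁻¹ * ∑ i, x i ^ 2 : ℝ) : ℂ) := by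
      push_cast
      simp only [mul_pow, Complex.I_sq, ← Finset.mul_sum]
      ring
    rw [this, Complex.ofReal_re]

theorem lintegral_norm_integral_gaussian_mul_wave {b : ℝ} (hb : 0 < b) :
    ∫⁻ x : Vec n, ‖∫ ξ : Vec n, (Real.exp (-b * ∑ i, ξ i ^ 2) : ℂ) * wave ξ x‖ₑ
      = ENNReal.ofReal ((2 * π) ^ n) := by
  simp_rw [← ofReal_norm, norm_integral_gaussian_mul_wave hb]
  rw [← ofReal_integral_eq_lintegral_ofReal
    ((integrable_gaussian_pi (by positivity)).const_mul _)
    (Filter.Eventually.of_forall fun _ => by positivity), integral_const_mul,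
    integral_gaussian_pi, ← mul_pow, ← Real.sqrt_mul (by positivity)]
  congr 2
  have : π / b * (π / (4 * b)⁻¹) = (2 * π) ^ 2 := by field_simp; ring
  rw [this, Real.sqrt_sq (by positivity)]

theorem aestronglyMeasurable_waveTransform {φ : Vec n → ℂ} (hφ : AEStronglyMeasurable φ) :
    AEStronglyMeasurable fun ξ : Vec n => ∫ y, φ y * wave ξ y := by
  refine AEStronglyMeasurable.integral_prod_right' (f := fun p : Vec n × Vec n =>
    φ p.2 * wave p.1 p.2) ?_
  exact hφ.comp_snd.mul (by fun_prop : Continuous fun p : Vec n × Vec n =>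
    wave p.1 p.2).aestronglyMeasurable

theorem lintegral_gaussian_mul_norm_sq_waveTransform_le {φ : Vec n → ℂ} (hφ : Integrable φ)
    {b : ℝ} (hb : 0 < b) :
    ∫⁻ ξ : Vec n, ENNReal.ofReal (Real.exp (-b * ∑ i, ξ i ^ 2)) * ‖∫ y, φ y * wave ξ y‖ₑ ^ 2
      ≤ 2 * ENNReal.ofReal ((2 * π) ^ n) * ∫⁻ y, ‖φ y‖ₑ ^ 2 := by
  set g : Vec n → ℝ := fun ξ => Real.exp (-b * ∑ i, ξ i ^ 2) with hg
  have hgi : Integrable g := integrable_gaussian_pi hb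
  set P : Vec n → ℂ := fun ξ => ∫ y, φ y * wave ξ y with hP
  set G : Vec n → ℂ := fun x => ∫ ξ, (g ξ : ℂ) * wave ξ x with hG
  have hPm : AEStronglyMeasurable P := aestronglyMeasurable_waveTransform hφ.1
  have hPb : ∀ ξ, ‖P ξ‖ ≤ ∫ y, ‖φ y‖ := fun ξ => by
    refine (norm_integral_le_integral_norm _).trans (le_of_eq ?_)
    simp [norm_wave]
  have hgP : Integrable fun ξ => g ξ * ‖P ξ‖ ^ 2 := by
    refine (hgi.mul_const ((∫ y, ‖φ y‖) ^ 2)).mono' (hgi.1.mul (hPm.norm.pow 2))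
      (Filter.Eventually.of_forall fun ξ => ?_)
    rw [Real.norm_of_nonneg (by positivity)]
    exact mul_le_mul_of_nonneg_left (pow_le_pow_left₀ (norm_nonneg _) (hPb ξ) 2)
      (Real.exp_pos _).le
  have hφφ : Integrable fun p : Vec n × Vec n => φ p.1 * (starRingEnd ℂ) (φ p.2) :=
    hφ.mul_prod (RCLike.conjCLE.toContinuousLinearMap.integrable_comp hφ)
  have hexp : ∀ ξ, ((g ξ * ‖P ξ‖ ^ 2 : ℝ) : ℂ)
      = ∫ p : Vec n × Vec n, (g ξ : ℂ) * wave ξ (p.1 - p.2)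
          * (φ p.1 * (starRingEnd ℂ) (φ p.2)) := by
    intro ξ
    have h1 : (starRingEnd ℂ) (P ξ) = ∫ y, (starRingEnd ℂ) (φ y) * wave ξ (-y) := by
      rw [hP, ← integral_conj]
      refine integral_congr_ae (Filter.Eventually.of_forall fun y => ?_)
      simp [wave, ← Complex.exp_conj]
    push_cast
    rw [← Complex.mul_conj', h1, hP, ← integral_prod_mul, ← Measure.volume_eq_prod,
      ← integral_const_mul]
    refine integral_congr_ae (Filter.Eventually.of_forall fun p => ?_)
    simp only [sub_eq_add_neg, wave_add_right]
    ring
  have hswap : ((∫ ξ, g ξ * ‖P ξ‖ ^ 2 : ℝ) : ℂ)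
      = ∫ p : Vec n × Vec n, G (p.1 - p.2) * (φ p.1 * (starRingEnd ℂ) (φ p.2)) := by
    rw [← integral_complex_ofReal]
    simp_rw [hexp]
    rw [integral_integral_swap]
    · simp_rw [integral_mul_const]
      rfl
    · have h3 : Integrable (fun q : Vec n × (Vec n × Vec n) => (g q.1 : ℂ)
          * (φ q.2.1 * (starRingEnd ℂ) (φ q.2.2))) (volume.prod volume) :=
        hgi.ofReal.mul_prod hφφ
      have h4 : Continuous fun q : Vec n × (Vec n × Vec n) => wave q.1 (q.2.1 - q.2.2) := by
        fun_prop
      refine (h3.bdd_mul (c := 1) h4.aestronglyMeasurable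
        (Filter.Eventually.of_forall fun q => (norm_wave _ _).le)).congr
        (Filter.Eventually.of_forall fun q => ?_)
      simp only [Function.uncurry]
      ring
  have hstep : ∫⁻ ξ, ENNReal.ofReal (g ξ) * ‖P ξ‖ₑ ^ 2
      = ‖((∫ ξ, g ξ * ‖P ξ‖ ^ 2 : ℝ) : ℂ)‖ₑ := by
    have h0 : 0 ≤ ∫ ξ, g ξ * ‖P ξ‖ ^ 2 :=
      integral_nonneg fun ξ => mul_nonneg (Real.exp_pos _).le (by positivity)
    rw [← ofReal_norm, Complex.norm_real, Real.norm_of_nonneg h0,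
      ofReal_integral_eq_lintegral_ofReal hgP
        (Filter.Eventually.of_forall fun ξ => mul_nonneg (Real.exp_pos _).le (by positivity))]
    refine lintegral_congr fun ξ => ?_
    rw [ENNReal.ofReal_mul (Real.exp_pos _).le, ENNReal.ofReal_pow (norm_nonneg _), ofReal_norm]
  have hGm : Measurable fun x : Vec n => ‖G x‖ₑ := by
    refine (StronglyMeasurable.integral_prod_right' (f := fun q : Vec n × Vec n =>
      (g q.2 : ℂ) * wave q.2 q.1) (Continuous.stronglyMeasurable ?_)).enorm
    fun_prop
  have hGi : ∫⁻ x, ‖G x‖ₑ = ENNReal.ofReal ((2 * π) ^ n) :=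
    lintegral_norm_integral_gaussian_mul_wave hb
  have hφe : AEMeasurable fun y => ‖φ y‖ₑ ^ 2 := hφ.1.enorm.pow_const 2
  change ∫⁻ ξ, ENNReal.ofReal (g ξ) * ‖P ξ‖ₑ ^ 2 ≤ _
  rw [hstep, hswap]
  have hab : ∀ a b : ENNReal, a * b ≤ a ^ 2 + b ^ 2 := fun a b => by
    rcases le_total a b with h | h
    · exact (mul_le_mul_left h b).trans ((pow_two b).symm.le.trans le_add_self)
    · exact (mul_le_mul_right h a).trans ((pow_two a).symm.le.trans le_self_add)
  calc _ ≤ ∫⁻ p : Vec n × Vec n, ‖G (p.1 - p.2) * (φ p.1 * (starRingEnd ℂ) (φ p.2))‖ₑ :=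
        enorm_integral_le_lintegral_enorm _
    _ ≤ ∫⁻ p : Vec n × Vec n, (‖φ p.1‖ₑ ^ 2 * ‖G (p.1 - p.2)‖ₑ
          + ‖φ p.2‖ₑ ^ 2 * ‖G (p.1 - p.2)‖ₑ) := by
        refine lintegral_mono fun p => ?_
        rw [enorm_mul, enorm_mul, RCLike.enorm_conj, ← add_mul, mul_comm]
        exact mul_le_mul_left (hab _ _) _
    _ = (∫⁻ p : Vec n × Vec n, ‖φ p.1‖ₑ ^ 2 * ‖G (p.1 - p.2)‖ₑ)
          + ∫⁻ p : Vec n × Vec n, ‖φ p.2‖ₑ ^ 2 * ‖G (p.1 - p.2)‖ₑ := by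
        refine lintegral_add_left' ?_ _
        exact (hφe.comp_fst).mul (hGm.comp (by fun_prop)).aemeasurable
    _ = (∫⁻ y, ‖φ y‖ₑ ^ 2) * ENNReal.ofReal ((2 * π) ^ n)
          + (∫⁻ y, ‖φ y‖ₑ ^ 2) * ENNReal.ofReal ((2 * π) ^ n) := by
        congr 1
        · rw [Measure.volume_eq_prod, lintegral_prod]
          · rw [← lintegral_mul_const'' _ hφe]
            refine lintegral_congr fun x => ?_
            have hm : Measurable fun y => ‖G (x - y)‖ₑ :=
              hGm.comp (measurable_const.sub measurable_id)
            change ∫⁻ y, ‖φ x‖ₑ ^ 2 * ‖G (x - y)‖ₑ = _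
            rw [lintegral_const_mul _ hm,
              lintegral_sub_left_eq_self (fun y => ‖G y‖ₑ) x, hGi]
          · exact (hφe.comp_fst).mul (hGm.comp (by fun_prop)).aemeasurable
        · rw [Measure.volume_eq_prod, lintegral_prod_symm]
          · rw [← lintegral_mul_const'' _ hφe]
            refine lintegral_congr fun x => ?_
            have hm : Measurable fun y => ‖G (y - x)‖ₑ :=
              hGm.comp (measurable_id.sub measurable_const)
            change ∫⁻ y, ‖φ x‖ₑ ^ 2 * ‖G (y - x)‖ₑ = _
            rw [lintegral_const_mul _ hm,
              lintegral_sub_right_eq_self (fun y => ‖G y‖ₑ) x, hGi]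
          · exact (hφe.comp_snd).mul (hGm.comp (by fun_prop)).aemeasurable
    _ = _ := by ring

theorem lintegral_norm_sq_waveTransform_le {φ : Vec n → ℂ} (hφ : Integrable φ) :
    ∫⁻ ξ : Vec n, ‖∫ y, φ y * wave ξ y‖ₑ ^ 2
      ≤ 2 * ENNReal.ofReal ((2 * π) ^ n) * ∫⁻ y, ‖φ y‖ₑ ^ 2 := by
  set F : ℕ → Vec n → ENNReal := fun k ξ =>
    ENNReal.ofReal (Real.exp (-(1 / ((k : ℝ) + 1)) * ∑ i, ξ i ^ 2)) * ‖∫ y, φ y * wave ξ y‖ₑ ^ 2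
    with hF
  have hlim : ∀ ξ, Filter.Tendsto (fun k => F k ξ) Filter.atTop
      (nhds (‖∫ y, φ y * wave ξ y‖ₑ ^ 2)) := by
    intro ξ
    have h1 : Filter.Tendsto (fun k : ℕ => Real.exp (-(1 / ((k : ℝ) + 1)) * ∑ i, ξ i ^ 2))
        Filter.atTop (nhds 1) := by
      have h := (tendsto_one_div_add_atTop_nhds_zero_nat (𝕜 := ℝ)).neg.mul_const (∑ i, ξ i ^ 2)
      simpa [Function.comp_def] using (Real.continuous_exp.tendsto _).comp h
    have h2 := ENNReal.Tendsto.mul_const (b := ‖∫ y, φ y * wave ξ y‖ₑ ^ 2)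
      (ENNReal.tendsto_ofReal h1) (Or.inl (by simp))
    simpa [hF] using h2
  calc _ = ∫⁻ ξ, Filter.liminf (fun k => F k ξ) Filter.atTop :=
        lintegral_congr fun ξ => (hlim ξ).liminf_eq.symm
    _ ≤ Filter.liminf (fun k => ∫⁻ ξ, F k ξ) Filter.atTop := by
        refine lintegral_liminf_le' fun k => ?_
        exact (by fun_prop : Measurable fun ξ : Vec n => ENNReal.ofReal
          (Real.exp (-(1 / ((k : ℝ) + 1)) * ∑ i, ξ i ^ 2))).aemeasurable.mul
          ((aestronglyMeasurable_waveTransform hφ.1).enorm.pow_const 2)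
    _ ≤ _ := by
        refine Filter.liminf_le_of_frequently_le' (Filter.Eventually.frequently
          (Filter.Eventually.of_forall fun k => ?_))
        exact lintegral_gaussian_mul_norm_sq_waveTransform_le hφ (by positivity)

theorem lintegral_norm_sq_waveTransform_neg_le {φ : Vec n → ℂ} (hφ : Integrable φ) :
    ∫⁻ ξ : Vec n, ‖∫ y, φ y * wave ξ (-y)‖ₑ ^ 2
      ≤ 2 * ENNReal.ofReal ((2 * π) ^ n) * ∫⁻ y, ‖φ y‖ₑ ^ 2 := by
  have h := lintegral_norm_sq_waveTransform_le hφ.comp_neg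
  rw [lintegral_neg_eq_self (fun y => ‖φ y‖ₑ ^ 2)] at h
  convert h using 4 with ξ
  rw [← integral_neg_eq_self]
  simp

end Plancherel

section PhaseSpace

variable {n : ℕ}

/-- The space of triples `(q, p, q')`. -/
abbrev TripleSpace (n : ℕ) := Vec n × Vec n × Vec n

/-- The coordinate directions of `TripleSpace n`. -/
def tripleDir : Fin n ⊕ Fin n ⊕ Fin n → TripleSpace n
  | .inl i => (Pi.single i 1, 0, 0)
  | .inr (.inl i) => (0, Pi.single i 1, 0)
  | .inr (.inr i) => (0, 0, Pi.single i 1)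

/-- The operator `∏ i, (1 + ∂_{q_i})`. -/
def firstOp (f : TripleSpace n → ℂ) : TripleSpace n → ℂ :=
  onePlusDeriv tripleDir (List.ofFn .inl) f

/-- The operator `∏ i, (1 + ∂_{p_i})`. -/
def secondOp (f : TripleSpace n → ℂ) : TripleSpace n → ℂ :=
  onePlusDeriv tripleDir (List.ofFn fun i => .inr (.inl i)) f

/-- The operator `∏ i, (1 + ∂_{q'_i})`. -/
def thirdOp (f : TripleSpace n → ℂ) : TripleSpace n → ℂ :=
  onePlusDeriv tripleDir (List.ofFn fun i => .inr (.inr i)) f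

/-- Smooth functions of `(q, p, q')` with all derivatives bounded. -/
def BoundedSymbol (f : TripleSpace n → ℂ) : Prop := SymbolClass tripleDir (fun _ => 1) f

variable {f g : TripleSpace n → ℂ}

theorem sum_smul_single (s : Vec n) : ∑ i, s i • (Pi.single i 1 : Vec n) = s := by
  ext i
  simp [Finset.sum_apply, Pi.single_apply]

namespace BoundedSymbol

theorem firstOp (hf : BoundedSymbol f) : BoundedSymbol (firstOp f) := hf.onePlusDeriv _

theorem secondOp (hf : BoundedSymbol f) : BoundedSymbol (secondOp f) := hf.onePlusDeriv _

theorem thirdOp (hf : BoundedSymbol f) : BoundedSymbol (thirdOp f) := hf.onePlusDeriv _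

theorem mul (hf : BoundedSymbol f) (hg : BoundedSymbol g) : BoundedSymbol fun z => f z * g z :=
  (SymbolClass.mul hf hg).mono fun _ => by norm_num

theorem continuous (hf : BoundedSymbol f) : Continuous f := hf.1.continuous

theorem exists_bound (hf : BoundedSymbol f) : ∃ C : ℝ, ∀ z, ‖f z‖ ≤ C := by
  simpa using SymbolClass.bound hf

theorem eq_integral_firstOp (hf : BoundedSymbol f) (x ξ y : Vec n) :
    f (x, ξ, y) = ∫ s : Vec n, (orthantExp s : ℂ) * _root_.firstOp f (x - s, ξ, y) := by
  rw [eq_integral_orthantExp (fun i : Fin n => Sum.inl i) hf (x, ξ, y)]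
  refine integral_congr_ae (Filter.Eventually.of_forall fun s => ?_)
  dsimp only
  congr 2
  refine Prod.ext ?_ (Prod.ext ?_ ?_) <;>
    simp [tripleDir, Prod.fst_sum, Prod.snd_sum, sum_smul_single]

theorem eq_integral_secondOp (hf : BoundedSymbol f) (x ξ y : Vec n) :
    f (x, ξ, y) = ∫ s : Vec n, (orthantExp s : ℂ) * _root_.secondOp f (x, ξ - s, y) := by
  rw [eq_integral_orthantExp (fun i : Fin n => Sum.inr (.inl i)) hf (x, ξ, y)]
  refine integral_congr_ae (Filter.Eventually.of_forall fun s => ?_)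
  dsimp only
  congr 2
  refine Prod.ext ?_ (Prod.ext ?_ ?_) <;>
    simp [tripleDir, Prod.fst_sum, Prod.snd_sum, sum_smul_single]

theorem eq_integral_thirdOp (hf : BoundedSymbol f) (x ξ y : Vec n) :
    f (x, ξ, y) = ∫ s : Vec n, (orthantExp s : ℂ) * _root_.thirdOp f (x, ξ, y - s) := by
  rw [eq_integral_orthantExp (fun i : Fin n => Sum.inr (.inr i)) hf (x, ξ, y)]
  refine integral_congr_ae (Filter.Eventually.of_forall fun s => ?_)
  dsimp only
  congr 2
  refine Prod.ext ?_ (Prod.ext ?_ ?_) <;>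
    simp [tripleDir, Prod.fst_sum, Prod.snd_sum, sum_smul_single]

end BoundedSymbol

theorem dirDeriv_third {u : Vec n → ℂ} (hu : ContDiff ℝ (⊤ : ℕ∞) u) (w : TripleSpace n) :
    dirDeriv w (fun z : TripleSpace n => u z.2.2) = fun z => dirDeriv w.2.2 u z.2.2 := by
  funext z
  have hL : HasFDerivAt (fun z : TripleSpace n => z.2.2)
      ((ContinuousLinearMap.snd ℝ (Vec n) (Vec n)).comp
        (ContinuousLinearMap.snd ℝ (Vec n) (Vec n × Vec n))) z :=
    (((ContinuousLinearMap.snd ℝ (Vec n) (Vec n)).comp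
        (ContinuousLinearMap.snd ℝ (Vec n) (Vec n × Vec n)))).hasFDerivAt
  have h := (hu.differentiable_of_smooth.differentiableAt (x := z.2.2)).hasFDerivAt.comp z hL
  unfold dirDeriv
  exact (congrArg (fun L => L w) h.fderiv).trans rfl

theorem boundedSymbol_third {u : Vec n → ℂ} (hu : ContDiff ℝ (⊤ : ℕ∞) u)
    (hc : HasCompactSupport u) : BoundedSymbol fun z : TripleSpace n => u z.2.2 := by
  refine ⟨hu.comp (by fun_prop), fun l => ?_⟩
  induction l generalizing u with
  | nil =>
    obtain ⟨C, hC⟩ := hu.continuous.bounded_above_of_compact_support hc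
    exact ⟨C, fun z => by simpa [listDeriv] using hC z.2.2⟩
  | cons i l ih =>
    simp only [listDeriv, dirDeriv_third hu]
    exact ih (hu.dirDeriv _) (hc.fderiv_apply (𝕜 := ℝ) _)

/-- The function `(q, p, q') ↦ ∏ i, (1 - i (q_i - q'_i))⁻¹`. -/
def resolventGap (z : TripleSpace n) : ℂ := resolventSymbol (z.1 - z.2.2)

theorem hasFDerivAt_gapFactor (j : Fin n) :
    ∃ L : TripleSpace n →L[ℝ] ℂ,
      ∀ z : TripleSpace n, HasFDerivAt
        (fun z : TripleSpace n => 1 - Complex.I * ((z.1 - z.2.2) j : ℂ)) L z := by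
  set P : TripleSpace n →L[ℝ] ℝ := (ContinuousLinearMap.proj j).comp
    (ContinuousLinearMap.fst ℝ (Vec n) (Vec n × Vec n)
      - (ContinuousLinearMap.snd ℝ (Vec n) (Vec n)).comp
        (ContinuousLinearMap.snd ℝ (Vec n) (Vec n × Vec n)))
  refine ⟨-(Complex.I • Complex.ofRealCLM.comp P), fun z => ?_⟩
  have h := ((Complex.I • Complex.ofRealCLM.comp P).hasFDerivAt (x := z)).const_sub 1
  exact h

theorem norm_inv_gapFactor_le_one (t : ℝ) : ‖(1 - Complex.I * (t : ℂ))⁻¹‖ ≤ 1 := by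
  rw [norm_inv]
  refine inv_le_one_of_one_le₀ ?_
  simpa using Complex.abs_re_le_norm (1 - Complex.I * (t : ℂ))

theorem gapFactor_ne_zero (t : ℝ) : 1 - Complex.I * (t : ℂ) ≠ 0 := fun h => by
  simpa using congrArg Complex.re h

theorem listDeriv_gapFactor (j : Fin n) (l : List (Fin n ⊕ Fin n ⊕ Fin n)) (c : ℂ) (m : ℕ) :
    ∃ c' : ℂ, listDeriv tripleDir l
      (fun z : TripleSpace n => c * (1 - Complex.I * ((z.1 - z.2.2) j : ℂ))⁻¹ ^ m)
      = fun z => c' * (1 - Complex.I * ((z.1 - z.2.2) j : ℂ))⁻¹ ^ (m + l.length) := by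
  induction l generalizing c m with
  | nil => exact ⟨c, rfl⟩
  | cons i l ih =>
    obtain ⟨L, hL⟩ := hasFDerivAt_gapFactor j
    have hd : dirDeriv (tripleDir i)
        (fun z : TripleSpace n => c * (1 - Complex.I * ((z.1 - z.2.2) j : ℂ))⁻¹ ^ m)
        = fun z => (-(c * m * L (tripleDir i)))
            * (1 - Complex.I * ((z.1 - z.2.2) j : ℂ))⁻¹ ^ (m + 1) := by
      funext z
      have h0 := gapFactor_ne_zero ((z.1 - z.2.2) j)
      have h1 := (((hasDerivAt_inv h0).pow m).const_mul c).hasFDerivAt.restrictScalars ℝ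
      have h2 := h1.comp z (hL z)
      unfold dirDeriv
      refine (congrArg (fun L => L (tripleDir i)) h2.fderiv).trans ?_
      set w := 1 - Complex.I * ((z.1 - z.2.2) j : ℂ)
      rcases m with _ | m
      · simp
      · simp [pow_succ]
        ring
    simp only [listDeriv, hd]
    obtain ⟨c', hc'⟩ := ih (-(c * m * L (tripleDir i))) (m + 1)
    refine ⟨c', hc'.trans ?_⟩
    simp only [List.length_cons]
    congr! 3
    ring

theorem symbolClass_resolventGap :
    SymbolClass tripleDir (fun z : TripleSpace n => ‖resolventGap z‖) resolventGap := by
  have h : ∀ j : Fin n, SymbolClass tripleDir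
      (fun z : TripleSpace n => ‖(1 - Complex.I * ((z.1 - z.2.2) j : ℂ))⁻¹‖)
      (fun z : TripleSpace n => (1 - Complex.I * ((z.1 - z.2.2) j : ℂ))⁻¹) := by
    intro j
    refine ⟨ContDiff.inv ?_ fun z => gapFactor_ne_zero _, fun l => ?_⟩
    · have : ContDiff ℝ (⊤ : ℕ∞) fun z : TripleSpace n => ((z.1 - z.2.2) j : ℝ) := by
        simp only [Pi.sub_apply]
        fun_prop
      exact contDiff_const.sub (contDiff_const.mul (Complex.ofRealCLM.contDiff.comp this))
    · obtain ⟨c, hc⟩ := listDeriv_gapFactor j l 1 1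
      simp only [one_mul, pow_one] at hc
      rw [hc]
      refine ⟨‖c‖, fun z => ?_⟩
      rw [norm_mul, add_comm, pow_succ, norm_mul, norm_pow]
      refine mul_le_mul_of_nonneg_left ?_ (norm_nonneg _)
      exact mul_le_of_le_one_left (norm_nonneg _)
        (pow_le_one₀ (norm_nonneg _) (norm_inv_gapFactor_le_one _))
  have := SymbolClass.prod Finset.univ h
  simp only [← norm_prod] at this
  exact this

theorem norm_resolventSymbol_le_one (w : Vec n) : ‖resolventSymbol w‖ ≤ 1 := by
  unfold resolventSymbol
  rw [norm_prod]
  exact Finset.prod_le_one (fun _ _ => norm_nonneg _) fun i _ => norm_inv_gapFactor_le_one _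

theorem boundedSymbol_resolventGap : BoundedSymbol (resolventGap (n := n)) :=
  symbolClass_resolventGap.mono fun _ => ⟨norm_nonneg _, norm_resolventSymbol_le_one _⟩

theorem onePlusDeriv_eq_zero_of_isOpen {E ι : Type*} [NormedAddCommGroup E] [NormedSpace ℝ E]
    {v : ι → E} (l : List ι) {f : E → ℂ} {O : Set E} (hO : IsOpen O) (hf : ∀ z ∈ O, f z = 0) :
    ∀ z ∈ O, onePlusDeriv v l f z = 0 := by
  induction l generalizing f with
  | nil => exact hf
  | cons i l ih =>
    refine ih fun z hz => ?_
    have h : f =ᶠ[nhds z] fun _ => 0 := Filter.eventually_of_mem (hO.mem_nhds hz) hf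
    simp [dirDeriv, h.fderiv_eq, hf z hz]

end PhaseSpace

section Decay

variable {n : ℕ} {f : TripleSpace n → ℂ} {u : Vec n → ℂ}

theorem thirdOp_eq_zero {S : Set (Vec n)} (hS : IsClosed S)
    (hf : ∀ x ξ y, y ∉ S → f (x, ξ, y) = 0) (x ξ y : Vec n) (hy : y ∉ S) :
    thirdOp f (x, ξ, y) = 0 := by
  have hO : IsOpen {z : TripleSpace n | z.2.2 ∉ S} :=
    hS.isOpen_compl.preimage (by fun_prop : Continuous fun z : TripleSpace n => z.2.2)
  exact onePlusDeriv_eq_zero_of_isOpen _ hO (fun z hz => hf z.1 z.2.1 z.2.2 hz) _ hy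

theorem integrable_slice_mul_wave (hf : Continuous f) {S : Set (Vec n)} (hS : IsCompact S)
    (hfS : ∀ x ξ y, y ∉ S → f (x, ξ, y) = 0) (x σ ξ : Vec n) :
    Integrable fun y => f (x, σ, y) * wave ξ (-y) := by
  refine Continuous.integrable_of_hasCompactSupport (by fun_prop)
    (HasCompactSupport.intro hS fun y hy => ?_)
  simp [hfS x σ y hy]

theorem integral_mul_wave_eq_thirdOp (hf : BoundedSymbol f) {S : Set (Vec n)} (hS : IsCompact S)
    (hfS : ∀ x ξ y, y ∉ S → f (x, ξ, y) = 0) (x σ ξ : Vec n) :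
    ∫ y, f (x, σ, y) * wave ξ (-y)
      = resolventSymbol (-ξ) * ∫ y, thirdOp f (x, σ, y) * wave ξ (-y) := by
  have hE : Integrable fun s : Vec n => (orthantExp s : ℂ) * wave s (-ξ) :=
    integrable_orthantExp.ofReal.mul_bdd (c := 1)
      (by fun_prop : Continuous fun s : Vec n => wave s (-ξ)).aestronglyMeasurable
      (Filter.Eventually.of_forall fun s => (norm_wave _ _).le)
  have hT := integrable_slice_mul_wave hf.thirdOp.continuous hS
    (thirdOp_eq_zero hS.isClosed hfS) x σ ξ
  have h := integral_convolution (ContinuousLinearMap.mul ℝ ℂ) hE hT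
  rw [integral_orthantExp_mul_wave] at h
  refine Eq.trans ?_ h
  refine integral_congr_ae (Filter.Eventually.of_forall fun y => ?_)
  simp only [convolution, ContinuousLinearMap.mul_apply']
  rw [hf.eq_integral_thirdOp, ← integral_mul_const]
  refine integral_congr_ae (Filter.Eventually.of_forall fun s => ?_)
  have e : wave ξ (-y) = wave s (-ξ) * wave ξ (-(y - s)) := by
    rw [wave_comm s, ← wave_neg_right, ← wave_add_right]
    congr 1
    abel
  simp only [e]
  ring

theorem exists_decay (hf : BoundedSymbol f) (hu : ContDiff ℝ (⊤ : ℕ∞) u)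
    (hc : HasCompactSupport u) :
    ∃ C : ℝ, ∀ x σ ξ : Vec n,
      ‖∫ y, f (x, σ, y) * wave ξ (-y) * u y‖ ≤ C * ‖resolventSymbol ξ‖ ^ 2 := by
  have hS : IsCompact (tsupport u) := hc
  set g : TripleSpace n → ℂ := fun z => f z * u z.2.2 with hg
  have hgB : BoundedSymbol g := hf.mul (boundedSymbol_third hu hc)
  have hgS : ∀ x ξ y, y ∉ tsupport u → g (x, ξ, y) = 0 := fun x ξ y hy => by
    simp [hg, image_eq_zero_of_notMem_tsupport hy]
  have hgS' := thirdOp_eq_zero hS.isClosed hgS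
  have hgS'' := thirdOp_eq_zero hS.isClosed hgS'
  obtain ⟨D, hD⟩ := hgB.thirdOp.thirdOp.exists_bound
  refine ⟨D * volume.real (tsupport u), fun x σ ξ => ?_⟩
  have e1 : ∫ y, f (x, σ, y) * wave ξ (-y) * u y = ∫ y, g (x, σ, y) * wave ξ (-y) := by
    refine integral_congr_ae (Filter.Eventually.of_forall fun y => ?_)
    simp only [hg]
    ring
  rw [e1, integral_mul_wave_eq_thirdOp hgB hS hgS,
    integral_mul_wave_eq_thirdOp hgB.thirdOp hS hgS', ← mul_assoc, norm_mul, norm_mul,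
    norm_resolventSymbol_neg, ← sq, mul_comm]
  refine mul_le_mul_of_nonneg_right ?_ (by positivity)
  have e2 : ∫ y, thirdOp (thirdOp g) (x, σ, y) * wave ξ (-y)
      = ∫ y in tsupport u, thirdOp (thirdOp g) (x, σ, y) * wave ξ (-y) := by
    refine (setIntegral_eq_integral_of_forall_compl_eq_zero fun y hy => ?_).symm
    simp [hgS'' x σ y hy]
  rw [e2]
  refine norm_setIntegral_le_of_norm_le_const hS.measure_lt_top fun y _ => ?_
  rw [norm_mul, norm_wave, mul_one]
  exact hD _

theorem integrable_mul_orthantExp_mul (hu : Continuous u) (hc : HasCompactSupport u)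
    {b : Vec n × Vec n → ℂ} (hb : Continuous b) {C : ℝ} (hC : ∀ p, ‖b p‖ ≤ C) :
    Integrable (fun p : Vec n × Vec n => u p.1 * (orthantExp p.2 : ℂ) * b p)
      (volume.prod volume) :=
  ((hu.integrable_of_hasCompactSupport hc).mul_prod integrable_orthantExp.ofReal).mul_bdd
    hb.aestronglyMeasurable (Filter.Eventually.of_forall hC)

theorem stronglyMeasurable_slice_integral {X : Type*} [TopologicalSpace X] [MeasurableSpace X]
    [OpensMeasurableSpace X] [SecondCountableTopology X]
    {F : X × Vec n → ℂ} (hF : Continuous F) : StronglyMeasurable fun p : X => ∫ y, F (p, y) :=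
  StronglyMeasurable.integral_prod_right' (f := F) hF.stronglyMeasurable

theorem integral_integral_phase_eq_secondOp (hf : BoundedSymbol f) (hu : ContDiff ℝ (⊤ : ℕ∞) u)
    (hc : HasCompactSupport u) (x : Vec n) :
    ∫ ξ : Vec n, ∫ y, f (x, ξ, y) * phase ξ x y * u y
      = ∫ ξ : Vec n, ∫ y, (secondOp f (x, ξ, y) * resolventGap (x, ξ, y)) * phase ξ x y * u y := by
  obtain ⟨C, hC⟩ := exists_decay hf.secondOp hu hc
  obtain ⟨D, hD⟩ := hf.secondOp.exists_bound
  have hfc := hf.secondOp.continuous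
  have huc := hu.continuous
  set V : Vec n → Vec n → ℂ := fun η ζ => ∫ y, secondOp f (x, η, y) * wave ζ (-y) * u y with hV
  set L : Vec n → Vec n → ℂ := fun τ ξ => (orthantExp τ : ℂ) * (wave ξ x * V (ξ - τ) ξ) with hL
  have hLm : AEStronglyMeasurable (Function.uncurry L) (volume.prod volume) := by
    have h1 : StronglyMeasurable fun p : Vec n × Vec n => V (p.2 - p.1) p.2 :=
      stronglyMeasurable_slice_integral (F := fun q : (Vec n × Vec n) × Vec n =>
        secondOp f (x, q.1.2 - q.1.1, q.2) * wave q.1.2 (-q.2) * u q.2) (by fun_prop)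
    have h2 : Continuous fun p : Vec n × Vec n => wave p.2 x := by fun_prop
    have h3 : Measurable fun p : Vec n × Vec n => (orthantExp p.1 : ℂ) := by fun_prop
    exact h3.aestronglyMeasurable.mul (h2.aestronglyMeasurable.mul h1.aestronglyMeasurable)
  have hLi : Integrable (Function.uncurry L) (volume.prod volume) := by
    refine (integrable_orthantExp.mul_prod
      (integrable_norm_sq_resolventSymbol.const_mul C)).mono' hLm
      (Filter.Eventually.of_forall fun p => ?_)
    simp only [Function.uncurry, hL]
    rw [norm_mul, norm_mul, norm_wave, one_mul, Complex.norm_real,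
      Real.norm_of_nonneg (orthantExp_nonneg _)]
    exact mul_le_mul_of_nonneg_left (hC x _ _) (orthantExp_nonneg _)
  have h1 : ∀ ξ, ∫ y, f (x, ξ, y) * phase ξ x y * u y = ∫ τ, L τ ξ := by
    intro ξ
    have e : ∀ y, f (x, ξ, y) * phase ξ x y * u y
        = ∫ τ, u y * (orthantExp τ : ℂ) * (secondOp f (x, ξ - τ, y) * phase ξ x y) := fun y => by
      rw [hf.eq_integral_secondOp, ← integral_mul_const, ← integral_mul_const]
      refine integral_congr_ae (Filter.Eventually.of_forall fun τ => ?_)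
      simp only
      ring
    simp_rw [e]
    rw [integral_integral_swap]
    · refine integral_congr_ae (Filter.Eventually.of_forall fun τ => ?_)
      simp only [hL, hV]
      rw [← integral_const_mul, ← integral_const_mul]
      refine integral_congr_ae (Filter.Eventually.of_forall fun y => ?_)
      simp only [phase_eq_wave]
      ring
    · refine integrable_mul_orthantExp_mul huc hc
        (b := fun p => secondOp f (x, ξ - p.2, p.1) * phase ξ x p.1) (C := D) ?_ fun p => ?_
      · simp only [phase_eq_wave]
        fun_prop
      · rw [norm_mul, phase_eq_wave, norm_mul, norm_wave, norm_wave, one_mul, mul_one]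
        exact hD _
  have h2 : ∀ η, ∫ τ, L τ (η + τ)
      = ∫ y, (secondOp f (x, η, y) * resolventGap (x, η, y)) * phase η x y * u y := by
    intro η
    have e : ∀ τ, L τ (η + τ) = ∫ y, u y * (orthantExp τ : ℂ)
        * (secondOp f (x, η, y) * phase η x y * wave τ (x - y)) := fun τ => by
      simp only [hL, hV]
      rw [← integral_const_mul, ← integral_const_mul]
      refine integral_congr_ae (Filter.Eventually.of_forall fun y => ?_)
      simp only [phase_eq_wave, wave_add_left, sub_eq_add_neg, wave_add_right,
        add_neg_cancel_right]
      ring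
    simp_rw [e]
    rw [← integral_integral_swap]
    · refine integral_congr_ae (Filter.Eventually.of_forall fun y => ?_)
      simp only [resolventGap]
      rw [← integral_orthantExp_mul_wave, ← integral_const_mul, ← integral_mul_const,
        ← integral_mul_const]
      refine integral_congr_ae (Filter.Eventually.of_forall fun τ => ?_)
      simp only
      ring
    · refine integrable_mul_orthantExp_mul huc hc
        (b := fun p => secondOp f (x, η, p.1) * phase η x p.1 * wave p.2 (x - p.1)) (C := D) ?_
        fun p => ?_
      · simp only [phase_eq_wave]
        fun_prop
      · rw [norm_mul, norm_mul, phase_eq_wave, norm_mul, norm_wave, norm_wave, norm_wave,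
          one_mul, mul_one, mul_one]
        exact hD _
  simp_rw [h1, ← h2]
  rw [integral_integral_swap (f := fun ξ τ => L τ ξ) hLi.swap]
  have hsh : Integrable (Function.uncurry fun η τ => L τ (η + τ)) (volume.prod volume) := by
    have hmp := (measurePreserving_prod_add (volume : Measure (Vec n)) (volume : Measure (Vec n)))
    have := (hmp.integrable_comp hLi.1).2 hLi
    refine this.swap.congr (Filter.Eventually.of_forall fun p => ?_)
    simp [Function.uncurry, add_comm]
  rw [integral_integral_swap hsh]
  refine integral_congr_ae (Filter.Eventually.of_forall fun τ => ?_)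
  exact (integral_add_right_eq_self (L τ) τ).symm

end Decay

section MainEstimate

variable {n : ℕ} {f : TripleSpace n → ℂ} {u : Vec n → ℂ}

theorem measurable_comp_pair {α : Type*} [MeasurableSpace α] (F : Vec n → Vec n → ENNReal)
    (hF : Measurable fun p : Vec n × Vec n => F p.1 p.2) (g k : α → Vec n) (hg : Measurable g)
    (hk : Measurable k) : Measurable fun a => F (g a) (k a) :=
  hF.comp (hg.prodMk hk)

theorem lintegral_orthantExp : ∫⁻ s : Vec n, ‖(orthantExp s : ℂ)‖ₑ = 1 := by
  have h : ∀ s : Vec n, ‖(orthantExp s : ℂ)‖ₑ = ENNReal.ofReal (orthantExp s) := fun s => by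
    rw [← ofReal_norm, Complex.norm_real, Real.norm_of_nonneg (orthantExp_nonneg _)]
  simp_rw [h]
  rw [← ofReal_integral_eq_lintegral_ofReal integrable_orthantExp
    (Filter.Eventually.of_forall orthantExp_nonneg), integral_orthantExp, ENNReal.ofReal_one]

theorem enorm_orthantExp_le_one (s : Vec n) : ‖(orthantExp s : ℂ)‖ₑ ≤ 1 := by
  rw [← ofReal_norm, Complex.norm_real, Real.norm_of_nonneg (orthantExp_nonneg _)]
  exact ENNReal.ofReal_le_one.2 (orthantExp_le_one s)

theorem enorm_integral_mul_sq_le {α : Type*} [MeasurableSpace α] {μ : Measure α} (φ ψ : α → ℂ) :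
    ‖∫ x, φ x * ψ x ∂μ‖ₑ ^ 2 ≤ (∫⁻ x, ‖φ x‖ₑ * ‖ψ x‖ₑ ∂μ) ^ 2 := by
  simp_rw [← enorm_mul]
  exact pow_le_pow_left₀ zero_le (enorm_integral_le_lintegral_enorm _) 2

/-- The `q'`-integral of `f(s, ξ, q') e^{-i ξ ⋅ q'} u(q')`. -/
def sliceTransform (f : TripleSpace n → ℂ) (u : Vec n → ℂ) (s ξ : Vec n) : ℂ :=
  ∫ y, f (s, ξ, y) * wave ξ (-y) * u y

theorem stronglyMeasurable_sliceTransform (hf : Continuous f) (hu : Continuous u) :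
    StronglyMeasurable fun p : Vec n × Vec n => sliceTransform f u p.1 p.2 :=
  stronglyMeasurable_slice_integral (F := fun q : (Vec n × Vec n) × Vec n =>
    f (q.1.1, q.1.2, q.2) * wave q.1.2 (-q.2) * u q.2) (by fun_prop)

theorem integral_integral_phase_eq_firstOp (hf : BoundedSymbol f) (hu : ContDiff ℝ (⊤ : ℕ∞) u)
    (hc : HasCompactSupport u) (x : Vec n) :
    ∫ ξ : Vec n, ∫ y, f (x, ξ, y) * phase ξ x y * u y
      = ∫ s : Vec n, (orthantExp s : ℂ) *
          ∫ ξ : Vec n, sliceTransform (firstOp f) u (x - s) ξ * wave ξ x := by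
  obtain ⟨C, hC⟩ := exists_decay hf.firstOp hu hc
  obtain ⟨D, hD⟩ := hf.firstOp.exists_bound
  have hfc := hf.firstOp.continuous
  have huc := hu.continuous
  have h1 : ∀ ξ, ∫ y, f (x, ξ, y) * phase ξ x y * u y
      = ∫ s : Vec n, (orthantExp s : ℂ) * (sliceTransform (firstOp f) u (x - s) ξ * wave ξ x) := by
    intro ξ
    have e : ∀ y, f (x, ξ, y) * phase ξ x y * u y
        = ∫ s, u y * (orthantExp s : ℂ) * (firstOp f (x - s, ξ, y) * phase ξ x y) := fun y => by
      rw [hf.eq_integral_firstOp, ← integral_mul_const, ← integral_mul_const]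
      refine integral_congr_ae (Filter.Eventually.of_forall fun s => ?_)
      simp only
      ring
    simp_rw [e]
    rw [integral_integral_swap]
    · refine integral_congr_ae (Filter.Eventually.of_forall fun s => ?_)
      simp only [sliceTransform]
      rw [← integral_mul_const, ← integral_const_mul]
      refine integral_congr_ae (Filter.Eventually.of_forall fun y => ?_)
      simp only [phase_eq_wave]
      ring
    · refine integrable_mul_orthantExp_mul huc hc
        (b := fun p => firstOp f (x - p.2, ξ, p.1) * phase ξ x p.1) (C := D) ?_ fun p => ?_
      · simp only [phase_eq_wave]
        fun_prop
      · rw [norm_mul, phase_eq_wave, norm_mul, norm_wave, norm_wave, one_mul, mul_one]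
        exact hD _
  simp_rw [h1]
  rw [integral_integral_swap]
  · simp_rw [integral_const_mul]
  · have hm : AEStronglyMeasurable (fun p : Vec n × Vec n => (orthantExp p.2 : ℂ) *
        (sliceTransform (firstOp f) u (x - p.2) p.1 * wave p.1 x)) (volume.prod volume) := by
      have h2 : Continuous fun p : Vec n × Vec n => wave p.1 x := by fun_prop
      have h3 : Measurable fun p : Vec n × Vec n => (orthantExp p.2 : ℂ) := by fun_prop
      have h4 := (stronglyMeasurable_sliceTransform hfc huc).comp_measurable
        (by fun_prop : Measurable fun p : Vec n × Vec n => (x - p.2, p.1))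
      exact h3.aestronglyMeasurable.mul (h4.aestronglyMeasurable.mul h2.aestronglyMeasurable)
    refine ((integrable_norm_sq_resolventSymbol.const_mul C).mul_prod
      integrable_orthantExp).mono' hm (Filter.Eventually.of_forall fun p => ?_)
    simp only [Function.uncurry]
    rw [norm_mul, norm_mul, norm_wave, mul_one, Complex.norm_real,
      Real.norm_of_nonneg (orthantExp_nonneg _), mul_comm]
    exact mul_le_mul_of_nonneg_right (hC _ _ _) (orthantExp_nonneg _)

theorem integrable_sliceTransform (hf : BoundedSymbol f) (hu : ContDiff ℝ (⊤ : ℕ∞) u)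
    (hc : HasCompactSupport u) (s : Vec n) : Integrable (sliceTransform f u s) := by
  obtain ⟨C, hC⟩ := exists_decay hf hu hc
  have hm := (stronglyMeasurable_sliceTransform hf.continuous hu.continuous).comp_measurable
    (by fun_prop : Measurable fun ξ : Vec n => (s, ξ))
  exact (integrable_norm_sq_resolventSymbol.const_mul C).mono' hm.aestronglyMeasurable
    (Filter.Eventually.of_forall fun ξ => hC s ξ ξ)

theorem lintegral_norm_sq_le_sliceTransform (hf : BoundedSymbol f) (hu : ContDiff ℝ (⊤ : ℕ∞) u)
    (hc : HasCompactSupport u) :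
    ∫⁻ x, ‖∫ ξ : Vec n, ∫ y, f (x, ξ, y) * phase ξ x y * u y‖ₑ ^ 2
      ≤ 2 * ENNReal.ofReal ((2 * π) ^ n)
        * ∫⁻ s, ∫⁻ ξ, ‖sliceTransform (firstOp f) u s ξ‖ₑ ^ 2 := by
  set H : Vec n → Vec n → ℂ := fun s x =>
    ∫ ξ : Vec n, sliceTransform (firstOp f) u s ξ * wave ξ x with hH
  have hHm : Measurable fun p : Vec n × Vec n => ‖H p.1 p.2‖ₑ := by
    have h1 := (stronglyMeasurable_sliceTransform hf.firstOp.continuous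
      hu.continuous).comp_measurable
        (by fun_prop : Measurable fun q : (Vec n × Vec n) × Vec n => (q.1.1, q.2))
    have h2 : Continuous fun q : (Vec n × Vec n) × Vec n => wave q.2 q.1.2 := by fun_prop
    exact (StronglyMeasurable.integral_prod_right' (h1.mul h2.stronglyMeasurable)).enorm
  have hpt : ∀ x, ‖∫ ξ : Vec n, ∫ y, f (x, ξ, y) * phase ξ x y * u y‖ₑ ^ 2
      ≤ ∫⁻ s, ‖H s x‖ₑ ^ 2 := by
    intro x
    rw [integral_integral_phase_eq_firstOp hf hu hc]
    have hHx : Measurable fun s => ‖H (x - s) x‖ₑ :=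
      measurable_comp_pair (fun s x => ‖H s x‖ₑ) hHm (fun s => x - s) (fun _ => x)
        (measurable_const.sub measurable_id) measurable_const
    have hEm : Measurable fun s : Vec n => ‖(orthantExp s : ℂ)‖ₑ := by fun_prop
    calc ‖∫ s, (orthantExp s : ℂ) * H (x - s) x‖ₑ ^ 2
        ≤ (∫⁻ s, ‖(orthantExp s : ℂ)‖ₑ * ‖H (x - s) x‖ₑ) ^ 2 := enorm_integral_mul_sq_le _ _
      _ ≤ (∫⁻ s, ‖(orthantExp s : ℂ)‖ₑ) * ∫⁻ s, ‖(orthantExp s : ℂ)‖ₑ * ‖H (x - s) x‖ₑ ^ 2 :=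
          sq_lintegral_mul_le hEm.aemeasurable hHx.aemeasurable
      _ ≤ ∫⁻ s, ‖H (x - s) x‖ₑ ^ 2 := by
          rw [lintegral_orthantExp, one_mul]
          exact lintegral_mono fun s => mul_le_of_le_one_left zero_le (enorm_orthantExp_le_one s)
      _ = _ := lintegral_sub_left_eq_self (fun s => ‖H s x‖ₑ ^ 2) x
  calc _ ≤ ∫⁻ x, ∫⁻ s, ‖H s x‖ₑ ^ 2 := lintegral_mono hpt
    _ = ∫⁻ s, ∫⁻ x, ‖H s x‖ₑ ^ 2 := by
        refine lintegral_lintegral_swap ?_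
        exact ((measurable_comp_pair (fun s x => ‖H s x‖ₑ) hHm (Prod.snd : Vec n × Vec n → Vec n)
          Prod.fst measurable_snd measurable_fst).pow_const 2).aemeasurable
    _ ≤ ∫⁻ s, 2 * ENNReal.ofReal ((2 * π) ^ n)
          * ∫⁻ ξ, ‖sliceTransform (firstOp f) u s ξ‖ₑ ^ 2 := by
        refine lintegral_mono fun s => ?_
        have := lintegral_norm_sq_waveTransform_le (integrable_sliceTransform hf.firstOp hu hc s)
        simpa only [hH, wave_comm] using this
    _ = _ := by
        refine lintegral_const_mul _ ?_
        exact Measurable.lintegral_prod_right' (f := fun p : Vec n × Vec n =>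
          ‖sliceTransform (firstOp f) u p.1 p.2‖ₑ ^ 2)
          ((stronglyMeasurable_sliceTransform hf.firstOp.continuous
            hu.continuous).enorm.pow_const 2)

/-- The Fourier transform of `q' ↦ E(q' - t) u(q')`, where `E` is `orthantExp`. -/
def windowTransform (u : Vec n → ℂ) (t ξ : Vec n) : ℂ :=
  ∫ y, (orthantExp (y - t) : ℂ) * u y * wave ξ (-y)

theorem stronglyMeasurable_windowTransform (hu : Continuous u) :
    StronglyMeasurable fun p : Vec n × Vec n => windowTransform u p.1 p.2 := by
  refine StronglyMeasurable.integral_prod_right' (f := fun q : (Vec n × Vec n) × Vec n =>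
    (orthantExp (q.2 - q.1.1) : ℂ) * u q.2 * wave q.1.2 (-q.2)) ?_
  have h1 : Measurable fun q : (Vec n × Vec n) × Vec n => (orthantExp (q.2 - q.1.1) : ℂ) :=
    Complex.measurable_ofReal.comp (measurable_orthantExp.comp (by fun_prop))
  have h2 : Continuous fun q : (Vec n × Vec n) × Vec n => wave q.1.2 (-q.2) := by fun_prop
  exact (h1.stronglyMeasurable.mul (by fun_prop : Continuous fun q : (Vec n × Vec n) × Vec n =>
    u q.2).stronglyMeasurable).mul h2.stronglyMeasurable

theorem sliceTransform_eq_integral_windowTransform (hf : BoundedSymbol f)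
    (hu : ContDiff ℝ (⊤ : ℕ∞) u) (hc : HasCompactSupport u) (s ξ : Vec n) :
    sliceTransform f u s ξ = ∫ t, thirdOp f (s, ξ, t) * windowTransform u t ξ := by
  obtain ⟨D, hD⟩ := hf.thirdOp.exists_bound
  have hfc := hf.thirdOp.continuous
  have huc := hu.continuous
  have e : ∀ y, f (s, ξ, y) * wave ξ (-y) * u y
      = ∫ t, thirdOp f (s, ξ, t) * ((orthantExp (y - t) : ℂ) * u y * wave ξ (-y)) := fun y => by
    rw [hf.eq_integral_thirdOp, ← integral_sub_left_eq_self (μ := volume) (x' := y),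
      ← integral_mul_const, ← integral_mul_const]
    refine integral_congr_ae (Filter.Eventually.of_forall fun t => ?_)
    simp only [sub_sub_cancel]
    ring
  unfold sliceTransform windowTransform
  simp_rw [e, ← integral_const_mul]
  rw [integral_integral_swap]
  have hui : Integrable u := hu.continuous.integrable_of_hasCompactSupport hc
  have h := hui.convolution_integrand
    (ν := volume) (μ := volume) (ContinuousLinearMap.mul ℝ ℂ)
    (integrable_orthantExp (n := n)).ofReal.comp_neg
  refine (h.swap.mul_bdd (c := D) (g := fun p : Vec n × Vec n =>
    thirdOp f (s, ξ, p.2) * wave ξ (-p.1)) ?_ ?_).congr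
    (Filter.Eventually.of_forall fun p => ?_)
  · exact (by fun_prop : Continuous fun p : Vec n × Vec n =>
      thirdOp f (s, ξ, p.2) * wave ξ (-p.1)).aestronglyMeasurable
  · refine Filter.Eventually.of_forall fun p => ?_
    rw [norm_mul, norm_wave, mul_one]
    exact hD _
  · simp [Function.uncurry]
    ring

theorem lintegral_lintegral_windowTransform_le (hu : Continuous u) (hc : HasCompactSupport u) :
    ∫⁻ t, ∫⁻ ξ, ‖windowTransform u t ξ‖ₑ ^ 2
      ≤ 2 * ENNReal.ofReal ((2 * π) ^ n) * ∫⁻ y, ‖u y‖ₑ ^ 2 := by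
  have hEm : Measurable fun p : Vec n × Vec n => ‖(orthantExp (p.2 - p.1) : ℂ)‖ₑ :=
    (Complex.measurable_ofReal.comp (measurable_orthantExp.comp (by fun_prop))).enorm
  have hm : Measurable fun p : Vec n × Vec n =>
      ‖(orthantExp (p.2 - p.1) : ℂ)‖ₑ * ‖u p.2‖ₑ ^ 2 :=
    hEm.mul ((by fun_prop : Continuous fun p : Vec n × Vec n => u p.2).measurable.enorm.pow_const 2)
  calc _ ≤ ∫⁻ t, 2 * ENNReal.ofReal ((2 * π) ^ n)
          * ∫⁻ y, ‖(orthantExp (y - t) : ℂ)‖ₑ * ‖u y‖ₑ ^ 2 := by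
        refine lintegral_mono fun t => ?_
        have hi : Integrable fun y => (orthantExp (y - t) : ℂ) * u y := by
          refine (hu.integrable_of_hasCompactSupport hc).bdd_mul (c := 1) ?_
            (Filter.Eventually.of_forall fun y => ?_)
          · exact (Complex.measurable_ofReal.comp (measurable_orthantExp.comp
              (by fun_prop))).aestronglyMeasurable
          · rw [Complex.norm_real, Real.norm_of_nonneg (orthantExp_nonneg _)]
            exact orthantExp_le_one _
        refine (lintegral_norm_sq_waveTransform_neg_le hi).trans (mul_le_mul_right ?_ _)
        refine lintegral_mono fun y => ?_
        rw [enorm_mul, mul_pow]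
        refine mul_le_mul_left ?_ _
        rw [sq]
        exact mul_le_of_le_one_left zero_le (enorm_orthantExp_le_one _)
    _ = 2 * ENNReal.ofReal ((2 * π) ^ n)
          * ∫⁻ t, ∫⁻ y, ‖(orthantExp (y - t) : ℂ)‖ₑ * ‖u y‖ₑ ^ 2 :=
        lintegral_const_mul _ hm.lintegral_prod_right'
    _ = _ := by
        rw [lintegral_lintegral_swap hm.aemeasurable]
        congr 1
        refine lintegral_congr fun y => ?_
        have hEy : Measurable fun t => ‖(orthantExp (y - t) : ℂ)‖ₑ :=
          measurable_comp_pair (fun t y => ‖(orthantExp (y - t) : ℂ)‖ₑ) hEm id (fun _ => y)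
            measurable_id measurable_const
        rw [lintegral_mul_const _ hEy,
          lintegral_sub_left_eq_self (fun t => ‖(orthantExp t : ℂ)‖ₑ) y, lintegral_orthantExp,
          one_mul]

theorem lintegral_lintegral_sliceTransform_le (hf : BoundedSymbol f)
    (hu : ContDiff ℝ (⊤ : ℕ∞) u) (hc : HasCompactSupport u) {K : ℝ}
    (hK : ∀ z, ‖thirdOp f z‖ ≤ K * ‖resolventGap z‖ ^ 2) :
    ∫⁻ s, ∫⁻ ξ, ‖sliceTransform f u s ξ‖ₑ ^ 2
      ≤ (ENNReal.ofReal K * ∫⁻ w : Vec n, ‖resolventSymbol w‖ₑ ^ 2) ^ 2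
        * (2 * ENNReal.ofReal ((2 * π) ^ n) * ∫⁻ y, ‖u y‖ₑ ^ 2) := by
  set I := ∫⁻ w : Vec n, ‖resolventSymbol w‖ₑ ^ 2 with hI
  set N : Vec n → ENNReal := fun t => ∫⁻ ξ, ‖windowTransform u t ξ‖ₑ ^ 2 with hN
  have hUm : Measurable fun p : Vec n × Vec n => ‖windowTransform u p.1 p.2‖ₑ :=
    (stronglyMeasurable_windowTransform hu.continuous).enorm
  have hNm : Measurable N := (hUm.pow_const 2).lintegral_prod_right'
  have hRm : Measurable fun p : Vec n × Vec n => ‖resolventSymbol (p.1 - p.2)‖ₑ ^ 2 :=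
    (continuous_resolventSymbol.comp (by fun_prop :
      Continuous fun p : Vec n × Vec n => p.1 - p.2)).measurable.enorm.pow_const 2
  have hK' : ∀ s ξ t, ‖thirdOp f (s, ξ, t)‖ₑ
      ≤ ENNReal.ofReal K * ‖resolventSymbol (s - t)‖ₑ ^ 2 := fun s ξ t => by
    rw [← ofReal_norm, ← ofReal_norm, ← ENNReal.ofReal_pow (norm_nonneg _),
      ← ENNReal.ofReal_mul' (by positivity)]
    exact ENNReal.ofReal_le_ofReal (hK (s, ξ, t))
  have hpt : ∀ s ξ, ‖sliceTransform f u s ξ‖ₑ ^ 2 ≤ ENNReal.ofReal K ^ 2 * I *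
      ∫⁻ t, ‖resolventSymbol (s - t)‖ₑ ^ 2 * ‖windowTransform u t ξ‖ₑ ^ 2 := by
    intro s ξ
    have hUξ : Measurable fun t => ‖windowTransform u t ξ‖ₑ :=
      measurable_comp_pair (fun t ξ => ‖windowTransform u t ξ‖ₑ) hUm id (fun _ => ξ)
        measurable_id measurable_const
    have hRs : Measurable fun t => ‖resolventSymbol (s - t)‖ₑ ^ 2 :=
      measurable_comp_pair (fun s t => ‖resolventSymbol (s - t)‖ₑ ^ 2) hRm (fun _ => s) id
        measurable_const measurable_id
    rw [sliceTransform_eq_integral_windowTransform hf hu hc]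
    calc ‖∫ t, thirdOp f (s, ξ, t) * windowTransform u t ξ‖ₑ ^ 2
        ≤ (∫⁻ t, ‖thirdOp f (s, ξ, t)‖ₑ * ‖windowTransform u t ξ‖ₑ) ^ 2 :=
          enorm_integral_mul_sq_le _ _
      _ ≤ (ENNReal.ofReal K *
            ∫⁻ t, ‖resolventSymbol (s - t)‖ₑ ^ 2 * ‖windowTransform u t ξ‖ₑ) ^ 2 := by
          refine pow_le_pow_left₀ zero_le (le_of_le_of_eq (lintegral_mono fun t =>
            (mul_le_mul_left (hK' s ξ t) _).trans_eq (mul_assoc _ _ _)) ?_) 2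
          exact lintegral_const_mul _ (hRs.mul hUξ)
      _ ≤ _ := by
          rw [mul_pow, mul_assoc]
          refine mul_le_mul_right ((sq_lintegral_mul_le hRs.aemeasurable
            hUξ.aemeasurable).trans (le_of_eq ?_)) _
          rw [lintegral_sub_left_eq_self (fun t => ‖resolventSymbol t‖ₑ ^ 2) s]
  calc _ ≤ ∫⁻ s, ENNReal.ofReal K ^ 2 * I * ∫⁻ t, ‖resolventSymbol (s - t)‖ₑ ^ 2 * N t := by
        refine lintegral_mono fun s => ?_
        have hm : Measurable fun p : Vec n × Vec n =>
            ‖resolventSymbol (s - p.2)‖ₑ ^ 2 * ‖windowTransform u p.2 p.1‖ₑ ^ 2 :=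
          (measurable_comp_pair (fun s t => ‖resolventSymbol (s - t)‖ₑ ^ 2) hRm
            (fun _ => s) Prod.snd measurable_const measurable_snd).mul
            ((measurable_comp_pair (fun t ξ => ‖windowTransform u t ξ‖ₑ) hUm Prod.snd
              Prod.fst measurable_snd measurable_fst).pow_const 2)
        refine (lintegral_mono (hpt s)).trans (le_of_eq ?_)
        rw [lintegral_const_mul _ hm.lintegral_prod_right',
          lintegral_lintegral_swap hm.aemeasurable]
        congr 1
        refine lintegral_congr fun t => ?_
        have hUt : Measurable fun ξ => ‖windowTransform u t ξ‖ₑ ^ 2 :=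
          (measurable_comp_pair (fun t ξ => ‖windowTransform u t ξ‖ₑ) hUm (fun _ => t) id
            measurable_const measurable_id).pow_const 2
        simp only [hN]
        exact lintegral_const_mul _ hUt
    _ = ENNReal.ofReal K ^ 2 * I * (I * ∫⁻ t, N t) := by
        have hm : Measurable fun p : Vec n × Vec n =>
            ‖resolventSymbol (p.1 - p.2)‖ₑ ^ 2 * N p.2 := hRm.mul (hNm.comp measurable_snd)
        rw [lintegral_const_mul _ hm.lintegral_prod_right',
          lintegral_lintegral_swap hm.aemeasurable, ← lintegral_const_mul _ hNm]
        congr 1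
        refine lintegral_congr fun t => ?_
        have hRt : Measurable fun s => ‖resolventSymbol (s - t)‖ₑ ^ 2 :=
          measurable_comp_pair (fun s t => ‖resolventSymbol (s - t)‖ₑ ^ 2) hRm id (fun _ => t)
            measurable_id measurable_const
        simp only
        rw [lintegral_mul_const _ hRt,
          lintegral_sub_right_eq_self (fun s => ‖resolventSymbol s‖ₑ ^ 2) t]
    _ ≤ ENNReal.ofReal K ^ 2 * I * (I *
          (2 * ENNReal.ofReal ((2 * π) ^ n) * ∫⁻ y, ‖u y‖ₑ ^ 2)) := by
        gcongr
        exact lintegral_lintegral_windowTransform_le hu.continuous hc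
    _ = _ := by ring

end MainEstimate

section FlatBound

variable {n : ℕ} {f : TripleSpace n → ℂ} {ω : TripleSpace n → ℝ} {k : ℕ}

namespace DerivBound

theorem firstOp (hf : DerivBound tripleDir (k + n) ω f) :
    DerivBound tripleDir k (fun z => 2 ^ n * ω z) (firstOp f) := by
  have := onePlusDeriv (v := tripleDir) (k := k) (f := f) (ω := ω)
    (List.ofFn fun i : Fin n => .inl i) (by rwa [List.length_ofFn])
  rwa [List.length_ofFn] at this

theorem secondOp (hf : DerivBound tripleDir (k + n) ω f) :
    DerivBound tripleDir k (fun z => 2 ^ n * ω z) (secondOp f) := by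
  have := onePlusDeriv (v := tripleDir) (k := k) (f := f) (ω := ω)
    (List.ofFn fun i : Fin n => .inr (.inl i)) (by rwa [List.length_ofFn])
  rwa [List.length_ofFn] at this

theorem thirdOp (hf : DerivBound tripleDir (k + n) ω f) :
    DerivBound tripleDir k (fun z => 2 ^ n * ω z) (thirdOp f) := by
  have := onePlusDeriv (v := tripleDir) (k := k) (f := f) (ω := ω)
    (List.ofFn fun i : Fin n => .inr (.inr i)) (by rwa [List.length_ofFn])
  rwa [List.length_ofFn] at this

end DerivBound

/-- The effect on the symbol of one integration by parts in `p`. -/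
def gainDecay (f : TripleSpace n → ℂ) : TripleSpace n → ℂ :=
  fun z => secondOp f z * resolventGap z

theorem BoundedSymbol.gainDecay (hf : BoundedSymbol f) : BoundedSymbol (gainDecay f) :=
  hf.secondOp.mul boundedSymbol_resolventGap

theorem exists_thirdOp_firstOp_gainDecay_le (n : ℕ) : ∃ C : ℝ, ∀ (f : TripleSpace n → ℂ) (K : ℝ),
    DerivBound tripleDir (4 * n) (fun _ => K) f →
      ∀ z, ‖thirdOp (firstOp (gainDecay (gainDecay f))) z‖ ≤ C * K * ‖resolventGap z‖ ^ 2 := by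
  obtain ⟨D, -, hD⟩ := symbolClass_resolventGap (n := n).exists_derivBound
    (fun _ => norm_nonneg _) (3 * n)
  refine ⟨2 ^ n * (2 ^ n * (2 ^ (2 * n) * (2 ^ n * (2 ^ (3 * n) * (2 ^ n * D)) * D))),
    fun f K hf z => ?_⟩
  have h1 : DerivBound tripleDir (3 * n) _ (gainDecay f) :=
    (hf.mono_order (by omega : 3 * n + n ≤ 4 * n)).secondOp.mul hD
  have h2 : DerivBound tripleDir (2 * n) _ (gainDecay (gainDecay f)) :=
    (h1.mono_order (by omega : 2 * n + n ≤ 3 * n)).secondOp.mul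
      (hD.mono_order (by omega : 2 * n ≤ 3 * n))
  have h3 := (h2.mono_order (by omega : 0 + n + n ≤ 2 * n)).firstOp.thirdOp.bound z
  exact h3.trans_eq (by ring)

theorem lintegral_enorm_sq_resolventSymbol_lt_top :
    ∫⁻ w : Vec n, ‖resolventSymbol w‖ₑ ^ 2 < ⊤ := by
  have h := (integrable_norm_sq_resolventSymbol (n := n)).2
  simpa [HasFiniteIntegral, enorm_pow] using h

/-- The `L²` bound for an amplitude with bounded derivatives. -/
theorem exists_lintegral_norm_sq_le (n : ℕ) : ∃ C : ENNReal, C ≠ ⊤ ∧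
    ∀ (f : TripleSpace n → ℂ) (K : ℝ), BoundedSymbol f →
      DerivBound tripleDir (4 * n) (fun _ => K) f →
      ∀ u : Vec n → ℂ, ContDiff ℝ (⊤ : ℕ∞) u → HasCompactSupport u →
        ∫⁻ x, ‖∫ ξ : Vec n, ∫ y, f (x, ξ, y) * phase ξ x y * u y‖ₑ ^ 2
          ≤ (C * ENNReal.ofReal K) ^ 2 * ∫⁻ y, ‖u y‖ₑ ^ 2 := by
  obtain ⟨C, hC⟩ := exists_thirdOp_firstOp_gainDecay_le n
  set κ : ENNReal := 2 * ENNReal.ofReal ((2 * π) ^ n) with hκ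
  set I := ∫⁻ w : Vec n, ‖resolventSymbol w‖ₑ ^ 2 with hI
  have hI' : I ≠ ⊤ := lintegral_enorm_sq_resolventSymbol_lt_top.ne
  have hκ' : κ ≠ ⊤ := ENNReal.mul_ne_top (by simp) ENNReal.ofReal_ne_top
  refine ⟨κ * I * ENNReal.ofReal C, ENNReal.mul_ne_top (ENNReal.mul_ne_top hκ' hI')
    ENNReal.ofReal_ne_top, fun f K hf hK u hu hc => ?_⟩
  have hK0 : 0 ≤ K := (norm_nonneg _).trans (hK.bound 0)
  have e : ∀ x, ∫ ξ : Vec n, ∫ y, f (x, ξ, y) * phase ξ x y * u y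
      = ∫ ξ : Vec n, ∫ y, gainDecay (gainDecay f) (x, ξ, y) * phase ξ x y * u y := fun x => by
    rw [integral_integral_phase_eq_secondOp hf hu hc]
    exact integral_integral_phase_eq_secondOp hf.gainDecay hu hc x
  simp_rw [e]
  have h2 := hf.gainDecay.gainDecay
  refine (lintegral_norm_sq_le_sliceTransform h2 hu hc).trans ?_
  refine (mul_le_mul_right
    (lintegral_lintegral_sliceTransform_le h2.firstOp hu hc (hC f K hK)) _).trans_eq ?_
  rw [ENNReal.ofReal_mul' hK0]
  ring

theorem integral_norm_sq_eq {φ : Vec n → ℂ}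
    (hφ : AEStronglyMeasurable (fun q => ‖φ q‖ ^ 2) volume) :
    ∫ q, ‖φ q‖ ^ 2 = (∫⁻ q, ‖φ q‖ₑ ^ 2).toReal := by
  rw [integral_eq_lintegral_of_nonneg_ae (Filter.Eventually.of_forall fun q => sq_nonneg _) hφ]
  congr 1
  refine lintegral_congr fun q => ?_
  rw [ENNReal.ofReal_pow (norm_nonneg _), ofReal_norm]

theorem integrable_norm_sq {u : Vec n → ℂ} (hu : Continuous u) (hs : HasCompactSupport u) :
    Integrable fun q => ‖u q‖ ^ 2 := by
  have h1 : Continuous fun q => ‖u q‖ ^ 2 := by fun_prop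
  refine h1.integrable_of_hasCompactSupport (HasCompactSupport.intro hs fun q hq => ?_)
  rw [image_eq_zero_of_notMem_tsupport hq]
  simp

theorem L2_le_of_lintegral_le {φ u : Vec n → ℂ} {c : ENNReal} (hc : c ≠ ⊤)
    (hu : Continuous u) (hs : HasCompactSupport u)
    (h : ∫⁻ q, ‖φ q‖ₑ ^ 2 ≤ c ^ 2 * ∫⁻ q, ‖u q‖ₑ ^ 2) : L2 φ ≤ c.toReal * L2 u := by
  unfold L2
  by_cases hi : Integrable fun q => ‖φ q‖ ^ 2
  · have hu1 := integrable_norm_sq hu hs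
    have hu2 : ∫⁻ q, ‖u q‖ₑ ^ 2 ≠ ⊤ := by
      have h2 := hu1.2
      simpa [HasFiniteIntegral, enorm_pow] using h2.ne
    rw [← Real.sqrt_sq (ENNReal.toReal_nonneg (a := c)), ← Real.sqrt_mul (sq_nonneg _),
      integral_norm_sq_eq hi.1, integral_norm_sq_eq hu1.1, ← ENNReal.toReal_pow,
      ← ENNReal.toReal_mul]
    exact Real.sqrt_le_sqrt (ENNReal.toReal_mono
      (ENNReal.mul_ne_top (ENNReal.pow_ne_top hc) hu2) h)
  · rw [integral_undef hi, Real.sqrt_zero]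
    exact mul_nonneg ENNReal.toReal_nonneg (Real.sqrt_nonneg _)

theorem exists_L2_Op_le (n : ℕ) : ∃ C : ℝ, 0 < C ∧
    ∀ (a : Vec n → Vec n → Vec n → ℂ) (K : ℝ),
      BoundedSymbol (fun z : TripleSpace n => a z.1 z.2.1 z.2.2) →
      DerivBound tripleDir (4 * n) (fun _ => K) (fun z : TripleSpace n => a z.1 z.2.1 z.2.2) →
      ∀ u : Vec n → ℂ, ContDiff ℝ (⊤ : ℕ∞) u → HasCompactSupport u →
        L2 (Op a u) ≤ C * K * L2 u := by
  obtain ⟨C, hC, h⟩ := exists_lintegral_norm_sq_le n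
  set c : ENNReal := ‖(((2 * Real.pi) ^ (-(n : ℤ)) : ℝ) : ℂ)‖ₑ with hc
  have hc' : c ≠ ⊤ := enorm_ne_top
  refine ⟨(c * C).toReal + 1, by positivity, fun a K ha hK u hu hs => ?_⟩
  have hK0 : 0 ≤ K := (norm_nonneg _).trans (hK.bound 0)
  have hL : 0 ≤ L2 u := Real.sqrt_nonneg _
  refine (L2_le_of_lintegral_le (c := c * C * ENNReal.ofReal K)
    (ENNReal.mul_ne_top (ENNReal.mul_ne_top hc' hC) ENNReal.ofReal_ne_top) hu.continuous hs
    ?_).trans ?_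
  · unfold Op
    simp_rw [enorm_mul, mul_pow]
    rw [lintegral_const_mul' _ _ (ENNReal.pow_ne_top hc')]
    refine (mul_le_mul_right (h _ K ha hK u hu hs) _).trans_eq ?_
    ring
  · rw [ENNReal.toReal_mul, ENNReal.toReal_ofReal hK0]
    gcongr
    simp

end FlatBound

section Multiindices

variable {n : ℕ} {E E' ι κ : Type*} [NormedAddCommGroup E] [NormedSpace ℝ E]
  [NormedAddCommGroup E'] [NormedSpace ℝ E']

theorem listDeriv_const_smul (v : ι → E) (l : List ι) (c : ℝ) (f : E → ℂ) :
    listDeriv v l (fun z => c • f z) = fun z => c • listDeriv v l f z := by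
  induction l generalizing f with
  | nil => rfl
  | cons i l ih =>
    have : dirDeriv (v i) (fun z => c • f z) = fun z => c • dirDeriv (v i) f z := by
      funext z
      simp only [dirDeriv]
      rw [show (fun z => c • f z) = c • f from rfl, fderiv_const_smul_field]
      rfl
    simp only [listDeriv, this, ih]

theorem listDeriv_comp_smul (v : ι → E) (l : List ι) (s : ℝ) {f : E → ℂ}
    (hf : ContDiff ℝ (⊤ : ℕ∞) f) :
    listDeriv v l (fun z => f (s • z)) = fun z => s ^ l.length • listDeriv v l f (s • z) := by
  induction l generalizing f with
  | nil => simp [listDeriv]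
  | cons i l ih =>
    have : dirDeriv (v i) (fun z => f (s • z)) = fun z => s • dirDeriv (v i) f (s • z) := by
      funext z
      have h := (hf.differentiable_of_smooth (s • z)).hasFDerivAt.comp z
        ((hasFDerivAt_id z).const_smul s)
      have h' : fderiv ℝ (fun z => f (s • z)) z = _ := h.fderiv
      simp only [dirDeriv, h']
      simp
    simp only [listDeriv, this, listDeriv_const_smul, ih (hf.dirDeriv (v i)), List.length_cons]
    funext z
    rw [smul_smul, pow_succ']

theorem listDeriv_comp_affine {v : ι → E} {v' : κ → E'} {j : ι → κ} {φ : E → E'} {L : E →L[ℝ] E'}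
    (hφ : ∀ x, HasFDerivAt φ L x) (hL : ∀ i, L (v i) = v' (j i)) (l : List ι) {f : E' → ℂ}
    (hf : ContDiff ℝ (⊤ : ℕ∞) f) (x : E) :
    listDeriv v l (fun x => f (φ x)) x = listDeriv v' (l.map j) f (φ x) := by
  induction l generalizing f with
  | nil => rfl
  | cons i l ih =>
    have : dirDeriv (v i) (fun x => f (φ x)) = fun x => dirDeriv (v' (j i)) f (φ x) := by
      funext x
      have h : fderiv ℝ (fun x => f (φ x)) x = _ :=
        ((hf.differentiable_of_smooth (φ x)).hasFDerivAt.comp x (hφ x)).fderiv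
      simp only [dirDeriv, h, ContinuousLinearMap.comp_apply, hL]
    simp only [listDeriv, this, List.map_cons, ih (hf.dirDeriv _)]

/-- The list of coordinates, with multiplicity, of a multiindex. -/
def multiList (A : Fin n → ℕ) : List (Fin n) :=
  (List.finRange n).reverse.flatMap fun i => List.replicate (A i) i

theorem count_multiList (A : Fin n → ℕ) (i : Fin n) : (multiList A).count i = A i := by
  have h : ∀ l : List (Fin n), l.Nodup →
      (l.flatMap fun i => List.replicate (A i) i).count i = if i ∈ l then A i else 0 := by
    intro l
    induction l with
    | nil => simp
    | cons j l ih =>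
      intro hl
      rw [List.nodup_cons] at hl
      rw [List.flatMap_cons, List.count_append, ih hl.2, List.count_replicate]
      by_cases hij : j = i
      · subst hij; simp [hl.1]
      · simp [hij, Ne.symm hij]
  rw [multiList, h _ (List.nodup_reverse.2 (List.nodup_finRange n))]
  simp

theorem length_multiList (A : Fin n → ℕ) : (multiList A).length = fullLen A := by
  have h := Multiset.sum_count_eq_card (s := Finset.univ) (m := (multiList A : Multiset (Fin n)))
    fun a _ => Finset.mem_univ a
  simpa [count_multiList, fullLen] using h.symm

theorem mpd_eq_listDeriv (A : Fin n → ℕ) (f : Vec n → ℂ) :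
    mpd A f = listDeriv (fun i => (Pi.single i 1 : Vec n)) (multiList A) f := by
  have hr : ∀ (i : Fin n) (m : ℕ) (g : Vec n → ℂ), (pdC i)^[m] g
      = listDeriv (fun i => (Pi.single i 1 : Vec n)) (List.replicate m i) g := by
    intro i m
    induction m with
    | zero => exact fun g => rfl
    | succ m ih => exact fun g => ih _
  unfold mpd multiList
  induction List.finRange n with
  | nil => rfl
  | cons i l ih =>
    rw [List.foldr_cons, ih, hr, List.reverse_cons, List.flatMap_append, listDeriv_append]
    simp

/-- The list of coordinates of a triple of multiindices. -/
def tripleList (A B A' : Fin n → ℕ) : List (Fin n ⊕ Fin n ⊕ Fin n) :=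
  (multiList A').map (fun i => .inr (.inr i)) ++ (multiList B).map (fun i => .inr (.inl i))
    ++ (multiList A).map (fun i => .inl i)

theorem d1B_d2B_d3B_eq_listDeriv {a : Vec n → Vec n → Vec n → ℂ}
    (ha : ContDiff ℝ (⊤ : ℕ∞) fun z : TripleSpace n => a z.1 z.2.1 z.2.2) (A B A' : Fin n → ℕ)
    (q p q' : Vec n) :
    d1B A (d2B B (d3B A' a)) q p q'
      = listDeriv tripleDir (tripleList A B A') (fun z => a z.1 z.2.1 z.2.2) (q, p, q') := by
  have h3 : ∀ q p q', d3B A' a q p q' = listDeriv tripleDir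
      ((multiList A').map fun i => .inr (.inr i)) (fun z => a z.1 z.2.1 z.2.2) (q, p, q') := by
    intro q p q'
    rw [d3B, mpd_eq_listDeriv]
    exact listDeriv_comp_affine (v := fun i => (Pi.single i 1 : Vec n)) (v' := tripleDir)
      (j := fun i => .inr (.inr i)) (φ := fun x : Vec n => ((q, p, x) : TripleSpace n))
      (fun x => (hasFDerivAt_const q x).prodMk ((hasFDerivAt_const p x).prodMk (hasFDerivAt_id x)))
      (fun i => rfl) _ ha q'
  have h2 : ∀ q p q', d2B B (d3B A' a) q p q' = listDeriv tripleDir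
      ((multiList B).map fun i => .inr (.inl i)) (listDeriv tripleDir
      ((multiList A').map fun i => .inr (.inr i)) (fun z => a z.1 z.2.1 z.2.2)) (q, p, q') := by
    intro q p q'
    rw [d2B, mpd_eq_listDeriv]
    simp_rw [h3]
    exact listDeriv_comp_affine (v := fun i => (Pi.single i 1 : Vec n)) (v' := tripleDir)
      (j := fun i => .inr (.inl i)) (φ := fun x : Vec n => ((q, x, q') : TripleSpace n))
      (fun x => (hasFDerivAt_const q x).prodMk ((hasFDerivAt_id x).prodMk (hasFDerivAt_const q' x)))
      (fun i => rfl) _ (ha.listDeriv _ _) p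
  rw [d1B, mpd_eq_listDeriv, tripleList, listDeriv_append, listDeriv_append]
  simp_rw [h2]
  exact listDeriv_comp_affine (v := fun i => (Pi.single i 1 : Vec n)) (v' := tripleDir)
      (j := fun i => .inl i) (φ := fun x : Vec n => ((x, p, q') : TripleSpace n))
    (fun x => (hasFDerivAt_id x).prodMk ((hasFDerivAt_const p x).prodMk (hasFDerivAt_const q' x)))
    (fun i => rfl) _ ((ha.listDeriv _ _).listDeriv _ _) q

theorem exists_perm_tripleList (l : List (Fin n ⊕ Fin n ⊕ Fin n)) :
    ∃ A B A' : Fin n → ℕ, l.Perm (tripleList A B A') := by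
  have h0 : ∀ (j : Fin n → Fin n ⊕ Fin n ⊕ Fin n) (l : Multiset (Fin n)) x,
      (∀ i, j i ≠ x) → (l.map j).count x = 0 := fun j l x hx => by
    rw [Multiset.count_eq_zero, Multiset.mem_map]
    exact fun ⟨i, _, hi⟩ => hx i hi
  suffices h : ∀ m : Multiset (Fin n ⊕ Fin n ⊕ Fin n), m = tripleList
      (fun i => m.count (Sum.inl i)) (fun i => m.count (Sum.inr (Sum.inl i)))
      fun i => m.count (Sum.inr (Sum.inr i)) from ⟨_, _, _, Multiset.coe_eq_coe.1 (h l)⟩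
  refine fun m => Multiset.ext.2 fun x => ?_
  have hc : ∀ (A : Fin n → ℕ) i, Multiset.count i (multiList A : Multiset (Fin n)) = A i :=
    fun A i => by rw [Multiset.coe_count, count_multiList]
  rw [tripleList, ← Multiset.coe_add, ← Multiset.coe_add, ← Multiset.map_coe, ← Multiset.map_coe,
    ← Multiset.map_coe, Multiset.count_add, Multiset.count_add]
  rcases x with i | i | i
  · rw [h0 (fun i => Sum.inr (Sum.inr i)) _ _ (by simp),
      h0 (fun i => Sum.inr (Sum.inl i)) _ _ (by simp),
      Multiset.count_map_eq_count' _ _ Sum.inl_injective, hc]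
    simp
  · rw [h0 (fun i => Sum.inr (Sum.inr i)) _ _ (by simp), h0 (fun i => Sum.inl i) _ _ (by simp),
      Multiset.count_map_eq_count' (fun i => Sum.inr (Sum.inl i)) _
        (Sum.inr_injective.comp Sum.inl_injective), hc]
    simp
  · rw [h0 (fun i => Sum.inr (Sum.inl i)) _ _ (by simp), h0 (fun i => Sum.inl i) _ _ (by simp),
      Multiset.count_map_eq_count' (fun i => Sum.inr (Sum.inr i)) _
        (Sum.inr_injective.comp Sum.inr_injective), hc]
    simp

theorem length_tripleList (A B A' : Fin n → ℕ) :
    (tripleList A B A').length = fullLen A + fullLen B + fullLen A' := by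
  simp only [tripleList, List.length_append, List.length_map, length_multiList]
  ring

theorem le_fullLen (A : Fin n → ℕ) (i : Fin n) : A i ≤ fullLen A :=
  Finset.single_le_sum (f := A) (fun _ _ => Nat.zero_le _) (Finset.mem_univ i)

end Multiindices

section Scaling

variable {n : ℕ} {a : Vec n → Vec n → Vec n → ℂ}

theorem L2_comp_smul (s : ℝ) (f : Vec n → ℂ) :
    L2 (fun x => f (s • x)) = √|(s ^ n)⁻¹| * L2 f := by
  unfold L2
  rw [Measure.integral_comp_smul volume (fun x => ‖f x‖ ^ 2) s, Module.finrank_fin_fun,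
    smul_eq_mul, Real.sqrt_mul (abs_nonneg _)]

theorem Oph_smul {h s : ℝ} (hs : 0 < s) (hh : h = s ^ 2) (u : Vec n → ℂ) (x : Vec n) :
    Oph h a u (s • x)
      = Op (fun q p q' => a (s • q) (s • p) (s • q')) (fun y => u (s • y)) x := by
  have hs0 : s ≠ 0 := hs.ne'
  unfold Oph Op
  congr 1
  set G : Vec n → Vec n → ℂ := fun p q' => a (s • x) (h • p) q' * phase p (s • x) q' * u q' with hG
  have h1 : ∀ p y : Vec n, a (s • x) (s • p) (s • y) * phase p x y * u (s • y)
      = G (s⁻¹ • p) (s • y) := fun p y => by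
    have e1 : h • s⁻¹ • p = s • p := by
      rw [smul_smul, hh]; congr 1; field_simp
    have e2 : phase (s⁻¹ • p) (s • x) (s • y) = phase p x y := by
      have e3 : ∀ i, (s⁻¹ • p) i * ((s • x) i - (s • y) i) = p i * (x i - y i) := fun i => by
        simp only [Pi.smul_apply, smul_eq_mul]
        field_simp
      simp only [phase, e3]
    rw [hG]
    simp only [e1, e2]
  simp_rw [h1]
  have h2 : ∀ p, ∫ y, G p (s • y) = |(s ^ n)⁻¹| • ∫ q', G p q' := fun p => by
    rw [Measure.integral_comp_smul volume (G p) s, Module.finrank_fin_fun]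
  simp_rw [h2]
  rw [integral_smul, Measure.integral_comp_smul volume (fun p => ∫ q', G p q') s⁻¹,
    Module.finrank_fin_fun, smul_smul, ← abs_mul, inv_pow, inv_inv, inv_mul_cancel₀ (by positivity),
    abs_one, one_smul]

theorem IsBisymbolOne.exists_bound [NeZero n] (ha : IsBisymbolOne 0 0 a) (A B A' : Fin n → ℕ) :
    ∃ C : ℝ, ∀ q p q', ‖d1B A (d2B B (d3B A' a)) q p q'‖ ≤ C := by
  obtain ⟨C, -, hC⟩ := ha.2 A B A'
  exact ⟨C, by simpa using hC⟩

theorem le_iSup_iSup_iSup {X Y Z : Type*} [Nonempty X] [Nonempty Y] [Nonempty Z]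
    {φ : X → Y → Z → ℝ} {C : ℝ} (hφ : ∀ x y z, φ x y z ≤ C) (x : X) (y : Y) (z : Z) :
    φ x y z ≤ ⨆ x, ⨆ y, ⨆ z, φ x y z := by
  have h1 : ∀ x y, BddAbove (Set.range (φ x y)) :=
    fun x y => ⟨C, Set.forall_mem_range.2 (hφ x y)⟩
  have h2 : ∀ x y, ⨆ z, φ x y z ≤ C := fun x y => ciSup_le (hφ x y)
  have h3 : ∀ x, BddAbove (Set.range fun y => ⨆ z, φ x y z) :=
    fun x => ⟨C, Set.forall_mem_range.2 (h2 x)⟩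
  have h4 : BddAbove (Set.range fun x => ⨆ y, ⨆ z, φ x y z) :=
    ⟨C, Set.forall_mem_range.2 fun x => ciSup_le (h2 x)⟩
  exact (le_ciSup (h1 x y) z).trans ((le_ciSup (h3 x) y).trans (le_ciSup h4 x))

theorem IsBisymbolOne.boundedSymbol [NeZero n] (ha : IsBisymbolOne 0 0 a) :
    BoundedSymbol fun z : TripleSpace n => a z.1 z.2.1 z.2.2 := by
  refine ⟨ha.1, fun l => ?_⟩
  obtain ⟨A, B, A', hl⟩ := exists_perm_tripleList l
  obtain ⟨C, hC⟩ := ha.exists_bound A B A'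
  refine ⟨C, fun z => ?_⟩
  rw [listDeriv_perm hl ha.1, ← d1B_d2B_d3B_eq_listDeriv ha.1 A B A' z.1 z.2.1 z.2.2, mul_one]
  exact hC _ _ _

theorem BoundedSymbol.comp_smul {f : TripleSpace n → ℂ} (hf : BoundedSymbol f) (s : ℝ) :
    BoundedSymbol fun z => f (s • z) := by
  refine ⟨hf.1.comp (contDiff_const_smul s), fun l => ?_⟩
  obtain ⟨C, hC⟩ := hf.2 l
  refine ⟨|s ^ l.length| * C, fun z => ?_⟩
  rw [listDeriv_comp_smul _ _ _ hf.1, norm_smul, Real.norm_eq_abs, mul_assoc]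
  exact mul_le_mul_of_nonneg_left (hC _) (abs_nonneg _)

theorem IsBisymbolOne.derivBound_comp_smul [NeZero n] (ha : IsBisymbolOne 0 0 a) {s : ℝ}
    (hs : 0 ≤ s) (M : ℕ) :
    DerivBound tripleDir M (fun _ =>
      ∑ A : Fin n → Fin (M + 1), ∑ B : Fin n → Fin (M + 1), ∑ A' : Fin n → Fin (M + 1),
        if fullLen (fun i => (A i : ℕ)) + fullLen (fun i => (B i : ℕ))
            + fullLen (fun i => (A' i : ℕ)) ≤ M then
          s ^ (fullLen (fun i => (A i : ℕ)) + fullLen (fun i => (B i : ℕ))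
              + fullLen (fun i => (A' i : ℕ))) *
            ⨆ q : Vec n, ⨆ p : Vec n, ⨆ q' : Vec n,
              ‖d1B (fun i => (A i : ℕ)) (d2B (fun i => (B i : ℕ))
                  (d3B (fun i => (A' i : ℕ)) a)) q p q'‖
        else 0)
      fun z : TripleSpace n => a (s • z.1) (s • z.2.1) (s • z.2.2) := by
  refine ⟨(ha.boundedSymbol.comp_smul s).1, fun l hl z => ?_⟩
  obtain ⟨A, B, A', hp⟩ := exists_perm_tripleList l
  have hlen : l.length = fullLen A + fullLen B + fullLen A' := by
    rw [hp.length_eq, length_tripleList]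
  have hA : ∀ i, A i < M + 1 := fun i => by have := le_fullLen A i; omega
  have hB : ∀ i, B i < M + 1 := fun i => by have := le_fullLen B i; omega
  have hA' : ∀ i, A' i < M + 1 := fun i => by have := le_fullLen A' i; omega
  obtain ⟨C, hC⟩ := ha.exists_bound A B A'
  set T : (Fin n → Fin (M + 1)) → (Fin n → Fin (M + 1)) → (Fin n → Fin (M + 1)) → ℝ :=
    fun A B A' => if fullLen (fun i => (A i : ℕ)) + fullLen (fun i => (B i : ℕ))
            + fullLen (fun i => (A' i : ℕ)) ≤ M then
          s ^ (fullLen (fun i => (A i : ℕ)) + fullLen (fun i => (B i : ℕ))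
              + fullLen (fun i => (A' i : ℕ))) *
            ⨆ q : Vec n, ⨆ p : Vec n, ⨆ q' : Vec n,
              ‖d1B (fun i => (A i : ℕ)) (d2B (fun i => (B i : ℕ))
                  (d3B (fun i => (A' i : ℕ)) a)) q p q'‖
        else 0 with hT
  have hT0 : ∀ A B A', 0 ≤ T A B A' := fun A B A' => by
    rw [hT]
    dsimp only
    split_ifs
    · exact mul_nonneg (pow_nonneg hs _) (Real.iSup_nonneg fun _ => Real.iSup_nonneg fun _ =>
        Real.iSup_nonneg fun _ => norm_nonneg _)
    · exact le_rfl
  have hmem : T (fun i => ⟨A i, hA i⟩) (fun i => ⟨B i, hB i⟩) (fun i => ⟨A' i, hA' i⟩)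
      ≤ ∑ A, ∑ B, ∑ A', T A B A' :=
    (Finset.single_le_sum (f := fun A' => T _ _ A') (fun _ _ => hT0 _ _ _)
      (Finset.mem_univ _)).trans ((Finset.single_le_sum (f := fun B => ∑ A', T _ B A')
        (fun _ _ => Finset.sum_nonneg fun _ _ => hT0 _ _ _) (Finset.mem_univ _)).trans
      (Finset.single_le_sum (f := fun A => ∑ B, ∑ A', T A B A')
        (fun _ _ => Finset.sum_nonneg fun _ _ => Finset.sum_nonneg fun _ _ => hT0 _ _ _)
        (Finset.mem_univ _)))
  refine le_trans ?_ hmem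
  rw [hT]
  dsimp only
  rw [if_pos (hlen ▸ hl), ← hlen]
  have e := congrFun (listDeriv_comp_smul tripleDir l s ha.boundedSymbol.1) z
  refine (congrArg norm e).trans_le ?_
  rw [norm_smul, norm_pow, Real.norm_of_nonneg hs, listDeriv_perm hp ha.boundedSymbol.1]
  refine mul_le_mul_of_nonneg_left ?_ (pow_nonneg hs _)
  have e' := d1B_d2B_d3B_eq_listDeriv ha.1 A B A' (s • z.1) (s • z.2.1) (s • z.2.2)
  exact (congrArg norm e').symm.trans_le (le_iSup_iSup_iSup hC _ _ _)

end Scaling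

end

/-- **Proposition 3.9 (semiclassical scaling bound).**  There are `C > 0` and `M ≥ 0`
such that
`‖Op_ħ(a)‖_{L²→L²} ≤ C ∑_{|A|+|B|+|A'| ≤ M} ħ^{(|A|+|B|+|A'|)/2} ‖∂_q^A ∂_p^B ∂_{q'}^{A'} a‖_{L^∞}`
for all `a ∈ BS⁰₀(1)` and all `ħ ∈ (0,1]`; the operator norm bound is expressed on the
dense subspace `C_c^∞(ℝⁿ)`. -/
theorem Oph_scaling_flat
    (n : ℕ) [NeZero n] :
    ∃ C > 0, ∃ M : ℕ, ∀ a : Vec n → Vec n → Vec n → ℂ, IsBisymbolOne 0 0 a →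
      ∀ h ∈ Set.Ioc (0 : ℝ) 1, ∀ u : Vec n → ℂ, ContDiff ℝ (⊤ : ℕ∞) u → HasCompactSupport u →
        L2 (Oph h a u)
          ≤ C * (∑ A : Fin n → Fin (M + 1), ∑ B : Fin n → Fin (M + 1),
                ∑ A' : Fin n → Fin (M + 1),
                if fullLen (fun i => (A i : ℕ)) + fullLen (fun i => (B i : ℕ))
                    + fullLen (fun i => (A' i : ℕ)) ≤ M then
                  Real.sqrt h ^ (fullLen (fun i => (A i : ℕ)) + fullLen (fun i => (B i : ℕ))
                      + fullLen (fun i => (A' i : ℕ))) *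
                    ⨆ q : Vec n, ⨆ p : Vec n, ⨆ q' : Vec n,
                      ‖d1B (fun i => (A i : ℕ)) (d2B (fun i => (B i : ℕ))
                          (d3B (fun i => (A' i : ℕ)) a)) q p q'‖
                else 0) * L2 u := by
  obtain ⟨C, hC, H⟩ := exists_L2_Op_le n
  refine ⟨C, hC, 4 * n, fun a ha h hh u hu hc => ?_⟩
  have hs : 0 < √h := Real.sqrt_pos.2 hh.1
  have key := H (fun q p q' => a (√h • q) (√h • p) (√h • q')) _
    (ha.boundedSymbol.comp_smul (√h)) (ha.derivBound_comp_smul hs.le (4 * n))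
    (fun y => u (√h • y)) (hu.comp (contDiff_const_smul _))
    (hc.comp_homeomorph (Homeomorph.smulOfNeZero (√h) hs.ne'))
  rw [L2_comp_smul, ← funext (Oph_smul hs (Real.sq_sqrt hh.1.le).symm u), L2_comp_smul,
    mul_left_comm] at key
  exact le_of_mul_le_mul_left key (Real.sqrt_pos.2 (by positivity))
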